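/- arXiv:1312.3902 — 2 statements merged into one kernel-verified Lean document; each statement's English description precedes it below -/
import Mathlib

section
/- (Second part of the periodic-annulus Korn-type theorem) There exist absolute constants σ > 0 and C₀ > 0 such that for any h ∈ (0,σ) and any φ = (u,v) ∈ H¹(I_h × [0,2π]; ℝ²) with φ(x,0) = φ(x,2π) in the sense of traces, ‖G_*‖² ≤ C₀ ( ‖e_*‖² + ‖e_*‖‖u‖/h + ‖v‖² ), where G_* = [[u_x, u_y − v],[v_x, v_y + u]] and e_* = (G_* + G_*ᵀ)/2. -/
open Real MeasureTheory

noncomputable section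

/-- x-partial derivative of a function on ℝ². -/
def dx (f : ℝ × ℝ → ℝ) (q : ℝ × ℝ) : ℝ := fderiv ℝ f q (1, 0)

/-- y-partial derivative of a function on ℝ². -/
def dy (f : ℝ × ℝ → ℝ) (q : ℝ × ℝ) : ℝ := fderiv ℝ f q (0, 1)

/-- The interval I_h = [1-h/2, 1+h/2]. -/
def Ih (h : ℝ) : Set ℝ := Set.Icc (1 - h/2) (1 + h/2)

/-- The rectangle I_h × [0,p]. -/
def rect (h p : ℝ) : Set (ℝ × ℝ) := Ih h ×ˢ Set.Icc 0 p

section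

open Complex

lemma mode_pointwise_bound {k h w t η η' ζ : ℝ} (hk : 1 ≤ |k|) (hh : 0 < h) (ht : 0 < t)
    (hw : π * |k| ≤ w) (hw' : w ≤ π * |k| + π / h) (hη0 : 0 ≤ η) (hη1 : η ≤ 1)
    (hη' : |η'| ≤ w) (hζ : |ζ| ≤ 1 / (2 * w)) (a a' b b' : ℂ) :
    k ^ 2 * ‖a‖ ^ 2 ≤
      200 * (‖a'‖ ^ 2 + ‖I * k * b + a‖ ^ 2 + ‖I * k * a - b + b'‖ ^ 2 + ‖b‖ ^ 2)
      + 2 * π / h * (t * ‖I * k * b + a‖ ^ 2 + ‖a‖ ^ 2 / t)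
      + 2 * (2 * η' * inner ℝ (I * k * b + a) a
        + 2 * η * (inner ℝ (I * k * b + a) a' + inner ℝ (I * k * b' + a') a)
        + k ^ 2 * (1 - 2 * η) * inner ℝ a a
        + k ^ 2 * ζ * (inner ℝ a a' + inner ℝ a' a)) := by
  set β := I * k * b + a with hβ
  set γ := I * k * a - b + b' with hγ
  have hβ' : I * k * b' + a' = (k ^ 2 : ℝ) • a + a' + (k : ℝ) • (I * (b + γ)) := by
    simp only [hγ, real_smul]
    push_cast
    linear_combination (-(k : ℂ) ^ 2 * a) * I_sq
  have e1 : inner ℝ (I * k * b' + a') a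
      = k ^ 2 * ‖a‖ ^ 2 + inner ℝ a' a + k * inner ℝ (I * (b + γ)) a := by
    rw [hβ', inner_add_left, inner_add_left, real_inner_smul_left, real_inner_smul_left,
      real_inner_self_eq_norm_sq]
  rw [e1, real_inner_self_eq_norm_sq, real_inner_comm a' a]
  have i1 := abs_real_inner_le_norm β a
  have i2 := abs_real_inner_le_norm a' a
  have i3 : |inner ℝ (I * (b + γ)) a| ≤ (‖b‖ + ‖γ‖) * ‖a‖ := by
    refine (abs_real_inner_le_norm _ _).trans ?_
    gcongr
    simpa using norm_add_le b γ
  have i4 := abs_real_inner_le_norm β a'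
  generalize inner ℝ β a = s₁ at *
  generalize inner ℝ a' a = s₂ at *
  generalize inner ℝ (I * (b + γ)) a = s₃ at *
  generalize inner ℝ β a' = s₄ at *
  have hA := norm_nonneg a
  have hA' := norm_nonneg a'
  have hB := norm_nonneg β
  have hG := norm_nonneg γ
  have hb := norm_nonneg b
  have hk2 : k ^ 2 = |k| ^ 2 := (sq_abs k).symm
  have hπ := Real.pi_gt_three
  have hπ' := Real.pi_lt_d2
  have hwpos : 0 < w := by nlinarith
  have hkζ : k ^ 2 * |ζ| ≤ |k| / 2 := by
    calc k ^ 2 * |ζ| ≤ |k| ^ 2 * (1 / (2 * w)) := by rw [hk2]; gcongr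
      _ ≤ |k| / 2 := by
        rw [mul_one_div, div_le_div_iff₀ (by positivity) (by positivity)]
        nlinarith
  generalize ‖a‖ = A at *
  generalize ‖a'‖ = A' at *
  generalize ‖β‖ = B at *
  generalize ‖γ‖ = G at *
  generalize ‖b‖ = b₀ at *
  have j1 : |η' * s₁| ≤ (π * |k| + π / h) * (B * A) := by
    rw [abs_mul]
    exact mul_le_mul (hη'.trans hw') i1 (abs_nonneg _) (by positivity)
  have j2 : |η * s₄| ≤ B * A' := by
    rw [abs_mul, abs_of_nonneg hη0]
    nlinarith [abs_nonneg s₄]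
  have j3 : |η * s₂| ≤ |k| * (A' * A) := by
    rw [abs_mul, abs_of_nonneg hη0]
    exact mul_le_mul (hη1.trans hk) i2 (abs_nonneg _) (by positivity)
  have j4 : |η * (k * s₃)| ≤ |k| * ((b₀ + G) * A) := by
    rw [abs_mul, abs_mul, abs_of_nonneg hη0]
    have : |k| * |s₃| ≤ |k| * ((b₀ + G) * A) := by gcongr
    nlinarith [mul_nonneg (abs_nonneg k) (abs_nonneg s₃)]
  have j5 : |k ^ 2 * ζ * s₂| ≤ |k| / 2 * (A' * A) := by
    rw [abs_mul, abs_mul, abs_of_nonneg (sq_nonneg k)]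
    exact mul_le_mul hkζ i2 (abs_nonneg _) (by positivity)
  have j6 : 2 * (B * A) ≤ t * B ^ 2 + A ^ 2 / t := by
    have : t * B ^ 2 + A ^ 2 / t - 2 * (B * A) = (t * B - A) ^ 2 / t := by
      field_simp
      ring
    have : 0 ≤ (t * B - A) ^ 2 / t := by positivity
    linarith
  have j7 : π / h * (2 * (B * A)) ≤ π / h * (t * B ^ 2 + A ^ 2 / t) := by gcongr
  have j8 : π * (|k| * (B * A)) ≤ 3.15 * (|k| * (B * A)) := by gcongr
  rw [abs_le] at j1 j2 j3 j4 j5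
  rw [show 2 * π / h * (t * B ^ 2 + A ^ 2 / t) = 2 * (π / h * (t * B ^ 2 + A ^ 2 / t)) by ring]
  generalize π / h * (t * B ^ 2 + A ^ 2 / t) = Q at *
  have key : 4 * (|k| * A * (3.15 * B + 1.5 * A' + b₀ + G)) ≤
      |k| ^ 2 * A ^ 2 + 4 * (3.15 * B + 1.5 * A' + b₀ + G) ^ 2 := by
    linarith [sq_nonneg (|k| * A - 2 * (3.15 * B + 1.5 * A' + b₀ + G))]
  have key2 : (3.15 * B + 1.5 * A' + b₀ + G) ^ 2 ≤
      4 * ((3.15 * B) ^ 2 + (1.5 * A') ^ 2 + b₀ ^ 2 + G ^ 2) := by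
    linarith [sq_nonneg (3.15 * B - 1.5 * A'), sq_nonneg (3.15 * B - b₀),
      sq_nonneg (3.15 * B - G), sq_nonneg (1.5 * A' - b₀), sq_nonneg (1.5 * A' - G),
      sq_nonneg (b₀ - G)]
  have key3 : 4 * (B * A') ≤ 2 * B ^ 2 + 2 * A' ^ 2 := by
    linarith [sq_nonneg (B - A')]
  have key4 : k ^ 2 * A ^ 2 = |k| ^ 2 * A ^ 2 := by rw [hk2]
  linarith [sq_nonneg B, sq_nonneg A', sq_nonneg b₀, sq_nonneg G]

lemma mode_integral_bound {k h t : ℝ} (hk : 1 ≤ |k|) (hh : 0 < h) (ht : 0 < t) (c : ℝ)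
    {a a' b b' : ℝ → ℂ} (ha : ∀ x, HasDerivAt a (a' x) x) (hb : ∀ x, HasDerivAt b (b' x) x)
    (ca' : Continuous a') (cb' : Continuous b') :
    ∫ x in c..c + h, k ^ 2 * ‖a x‖ ^ 2 ≤
      ∫ x in c..c + h,
        (200 * (‖a' x‖ ^ 2 + ‖I * k * b x + a x‖ ^ 2 + ‖I * k * a x - b x + b' x‖ ^ 2
          + ‖b x‖ ^ 2)
        + 2 * π / h * (t * ‖I * k * b x + a x‖ ^ 2 + ‖a x‖ ^ 2 / t)) := by
  have ca : Continuous a := continuous_iff_continuousAt.2 fun x => (ha x).continuousAt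
  have cb : Continuous b := continuous_iff_continuousAt.2 fun x => (hb x).continuousAt
  set N := ⌈|k| * h⌉₊
  set w := π * N / h with hw
  have hNpos : 0 < |k| * h := by positivity
  have hN1 : |k| * h ≤ N := Nat.le_ceil _
  have hN2 : (N : ℝ) < |k| * h + 1 := Nat.ceil_lt_add_one hNpos.le
  have hw1 : π * |k| ≤ w := by
    rw [hw, le_div_iff₀ hh]
    nlinarith [Real.pi_pos]
  have hw2 : w ≤ π * |k| + π / h := by
    rw [hw, div_le_iff₀ hh, add_mul, div_mul_cancel₀ _ hh.ne']
    nlinarith [Real.pi_pos]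
  have hwpos : 0 < w := lt_of_lt_of_le (by positivity) hw1
  have hθ : ∀ x, HasDerivAt (fun x => w * (x - c)) w x := fun x => by
    simpa using ((hasDerivAt_id x).sub_const c).const_mul w
  have hη : ∀ x, HasDerivAt (fun x => 2 * Real.sin (w * (x - c)) ^ 2)
      (2 * (w * Real.sin (2 * (w * (x - c))))) x := fun x => by
    refine (((hθ x).sin.pow 2).const_mul 2).congr_deriv ?_
    rw [Real.sin_two_mul]
    push_cast
    ring
  have hζ : ∀ x, HasDerivAt (fun x => k ^ 2 * (Real.sin (2 * (w * (x - c))) / (2 * w)))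
      (k ^ 2 * (1 - 2 * Real.sin (w * (x - c)) ^ 2)) x := fun x => by
    refine (((((hθ x).const_mul 2).sin).div_const (2 * w)).const_mul (k ^ 2)).congr_deriv ?_
    rw [Real.cos_two_mul, Real.cos_sq']
    field_simp
    ring
  have hβ : ∀ x, HasDerivAt (fun x => I * k * b x + a x) (I * k * b' x + a' x) x :=
    fun x => ((hb x).const_mul _).add (ha x)
  have hP : ∀ x, HasDerivAt (fun x => 2 * Real.sin (w * (x - c)) ^ 2 *
        inner ℝ (I * k * b x + a x) (a x)
        + k ^ 2 * (Real.sin (2 * (w * (x - c))) / (2 * w)) * inner ℝ (a x) (a x))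
      (2 * (w * Real.sin (2 * (w * (x - c)))) * inner ℝ (I * k * b x + a x) (a x)
        + 2 * Real.sin (w * (x - c)) ^ 2 *
          (inner ℝ (I * k * b x + a x) (a' x) + inner ℝ (I * k * b' x + a' x) (a x))
        + k ^ 2 * (1 - 2 * Real.sin (w * (x - c)) ^ 2) * inner ℝ (a x) (a x)
        + k ^ 2 * (Real.sin (2 * (w * (x - c))) / (2 * w)) *
          (inner ℝ (a x) (a' x) + inner ℝ (a' x) (a x))) x := fun x => by
    refine (((hη x).mul ((hβ x).inner ℝ (ha x))).add
      ((hζ x).mul ((ha x).inner ℝ (ha x)))).congr_deriv ?_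
    ring
  have hInt := intervalIntegral.integral_eq_sub_of_hasDerivAt (a := c) (b := c + h)
    (fun x _ => hP x) (Continuous.intervalIntegrable (by fun_prop) _ _)
  have hend : w * (c + h - c) = N * π := by
    rw [hw]
    field_simp
    ring
  have hend2 : 2 * (w * (c + h - c)) = (2 * N : ℕ) * π := by
    rw [hend]
    push_cast
    ring
  rw [hend2, hend, Real.sin_nat_mul_pi, Real.sin_nat_mul_pi] at hInt
  simp only [sub_self, mul_zero, Real.sin_zero, ne_eq, OfNat.ofNat_ne_zero, not_false_eq_true,
    zero_pow, zero_mul, zero_div, add_zero] at hInt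
  rw [← add_zero (∫ x in c..c + h, (200 * _ + _)), ← mul_zero (2 : ℝ), ← hInt,
    ← intervalIntegral.integral_const_mul, ← intervalIntegral.integral_add
      (Continuous.intervalIntegrable (by fun_prop) _ _)
      (Continuous.intervalIntegrable (by fun_prop) _ _)]
  refine intervalIntegral.integral_mono_on (by linarith)
    (Continuous.intervalIntegrable (by fun_prop) _ _)
    (Continuous.intervalIntegrable (by fun_prop) _ _) fun x _ => ?_
  refine mode_pointwise_bound hk hh ht hw1 hw2 (sq_nonneg _) (Real.sin_sq_le_one _) ?_ ?_ _ _ _ _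
  · rw [abs_mul, abs_of_pos hwpos]
    exact mul_le_of_le_one_right hwpos.le (Real.abs_sin_le_one _)
  · rw [abs_div, abs_of_pos (by positivity : 0 < 2 * w)]
    gcongr
    exact Real.abs_sin_le_one _

/-- The `k`-th Fourier coefficient of `f (x, ·)` on `[0, 2 * π]`, as a function of `x`. -/
def sliceCoeff (f : ℝ × ℝ → ℝ) (k : ℤ) (x : ℝ) : ℂ :=
  fourierCoeffOn two_pi_pos (fun y => (f (x, y) : ℂ)) k

/-- The character `y ↦ exp (-i k y)`. -/
def sliceChar (k : ℤ) (y : ℝ) : ℂ := fourier (-k) (y : AddCircle (2 * π - 0))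

lemma continuous_sliceChar (k : ℤ) : Continuous (sliceChar k) :=
  (fourier (T := 2 * π - 0) (-k)).continuous.comp (AddCircle.continuous_mk' _)

lemma norm_sliceChar (k : ℤ) (y : ℝ) : ‖sliceChar k y‖ = 1 := Circle.norm_coe _

lemma sliceCoeff_eq (f : ℝ × ℝ → ℝ) (k : ℤ) (x : ℝ) :
    sliceCoeff f k x = (1 / (2 * π - 0)) • ∫ y in 0..2 * π, sliceChar k y * (f (x, y) : ℂ) :=
  fourierCoeffOn_eq_integral _ _ _

lemma continuous_sliceCoeff {f : ℝ × ℝ → ℝ} (hf : Continuous f) (k : ℤ) :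
    Continuous (sliceCoeff f k) := by
  have := continuous_sliceChar k
  simp_rw [funext (sliceCoeff_eq f k)]
  refine Continuous.fun_const_smul ?_ _
  refine intervalIntegral.continuous_parametric_intervalIntegral_of_continuous'
    (f := fun x y => sliceChar k y * (f (x, y) : ℂ)) ?_ _ _
  simp only [Function.uncurry_def]
  fun_prop

lemma sliceCoeff_add {f g : ℝ × ℝ → ℝ} (hf : Continuous f) (hg : Continuous g) (k : ℤ) (x : ℝ) :
    sliceCoeff (fun q => f q + g q) k x = sliceCoeff f k x + sliceCoeff g k x := by
  have := continuous_sliceChar k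
  simp only [sliceCoeff_eq, ofReal_add, mul_add]
  rw [intervalIntegral.integral_add (Continuous.intervalIntegrable (by fun_prop) _ _)
    (Continuous.intervalIntegrable (by fun_prop) _ _), smul_add]

lemma sliceCoeff_sub {f g : ℝ × ℝ → ℝ} (hf : Continuous f) (hg : Continuous g) (k : ℤ) (x : ℝ) :
    sliceCoeff (fun q => f q - g q) k x = sliceCoeff f k x - sliceCoeff g k x := by
  have := continuous_sliceChar k
  simp only [sliceCoeff_eq, ofReal_sub, mul_sub]
  rw [intervalIntegral.integral_sub (Continuous.intervalIntegrable (by fun_prop) _ _)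
    (Continuous.intervalIntegrable (by fun_prop) _ _), smul_sub]

lemma hasDerivAt_dx {f : ℝ × ℝ → ℝ} (hf : Differentiable ℝ f) (x y : ℝ) :
    HasDerivAt (fun s => f (s, y)) (dx f (x, y)) x :=
  (hf (x, y)).hasFDerivAt.comp_hasDerivAt x ((hasDerivAt_id x).prodMk (hasDerivAt_const x y))

lemma hasDerivAt_dy {f : ℝ × ℝ → ℝ} (hf : Differentiable ℝ f) (x y : ℝ) :
    HasDerivAt (fun s => f (x, s)) (dy f (x, y)) y :=
  (hf (x, y)).hasFDerivAt.comp_hasDerivAt y ((hasDerivAt_const y x).prodMk (hasDerivAt_id y))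

lemma continuous_dx {f : ℝ × ℝ → ℝ} (hf : ContDiff ℝ 1 f) : Continuous (dx f) :=
  (hf.continuous_fderiv one_ne_zero).clm_apply continuous_const

lemma continuous_dy {f : ℝ × ℝ → ℝ} (hf : ContDiff ℝ 1 f) : Continuous (dy f) :=
  (hf.continuous_fderiv one_ne_zero).clm_apply continuous_const

lemma hasDerivAt_sliceCoeff {f : ℝ × ℝ → ℝ} (hf : ContDiff ℝ 1 f) (k : ℤ) (x : ℝ) :
    HasDerivAt (sliceCoeff f k) (sliceCoeff (dx f) k x) x := by
  have hχ := continuous_sliceChar k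
  have hc := hf.continuous
  have hd := continuous_dx hf
  have hdiff := hf.differentiable one_ne_zero
  obtain ⟨M, hM⟩ := (((isCompact_closedBall x 1).prod
    (isCompact_uIcc (a := (0 : ℝ)) (b := 2 * π))).image_of_continuousOn
      hd.continuousOn).isBounded.exists_norm_le
  rw [funext (sliceCoeff_eq f k), sliceCoeff_eq]
  refine HasDerivAt.fun_const_smul _ ?_
  refine (intervalIntegral.hasDerivAt_integral_of_dominated_loc_of_deriv_le (𝕜 := ℝ)
    (F := fun x y => sliceChar k y * (f (x, y) : ℂ))
    (F' := fun x y => sliceChar k y * (dx f (x, y) : ℂ)) (bound := fun _ => M)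
    (Metric.ball_mem_nhds x one_pos) (.of_forall fun s => ?_) ?_ ?_
    (.of_forall fun y hy s hs => ?_) (by simp) (.of_forall fun y _ s _ => ?_)).2
  · exact Continuous.aestronglyMeasurable (by fun_prop)
  · exact Continuous.intervalIntegrable (by fun_prop) _ _
  · exact Continuous.aestronglyMeasurable (by fun_prop)
  · rw [norm_mul, norm_sliceChar, one_mul, norm_real]
    exact hM _ ⟨(s, y), ⟨Metric.ball_subset_closedBall hs, Set.uIoc_subset_uIcc hy⟩, rfl⟩
  · exact (hasDerivAt_dx hdiff s y).ofReal_comp.const_mul _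

lemma sliceCoeff_dy {f : ℝ × ℝ → ℝ} (hf : ContDiff ℝ 1 f) (k : ℤ) {x : ℝ}
    (hx : f (x, 0) = f (x, 2 * π)) :
    sliceCoeff (dy f) k x = I * k * sliceCoeff f k x := by
  have hd := continuous_dy hf
  have hdiff := hf.differentiable one_ne_zero
  have hderiv : ∀ y, HasDerivAt (fun y => (f (x, y) : ℂ)) (dy f (x, y) : ℂ) y :=
    fun y => (hasDerivAt_dy hdiff x y).ofReal_comp
  have hInt : IntervalIntegrable (fun y => (dy f (x, y) : ℂ)) volume 0 (2 * π) :=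
    Continuous.intervalIntegrable (by fun_prop) _ _
  rcases eq_or_ne k 0 with rfl | hk
  · have : ∀ y, sliceChar 0 y = 1 := fun y => by simp [sliceChar]
    simp only [sliceCoeff_eq, this, one_mul]
    rw [intervalIntegral.integral_eq_sub_of_hasDerivAt (fun y _ => hderiv y) hInt]
    simp [hx]
  · have h := fourierCoeffOn_of_hasDerivAt two_pi_pos hk (fun y _ => hderiv y) hInt
    simp only [hx, sub_self, mul_zero, ofReal_zero, sub_zero, zero_sub] at h
    have hkC : (k : ℂ) ≠ 0 := by exact_mod_cast hk
    have hπ : (π : ℂ) ≠ 0 := by exact_mod_cast pi_ne_zero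
    have hI := I_ne_zero
    simp only [sliceCoeff]
    rw [h]
    push_cast
    field_simp

lemma hasSum_integral_norm_sliceCoeff_sq {f : ℝ × ℝ → ℝ} (hf : Continuous f) {c d : ℝ}
    (hcd : c ≤ d) :
    HasSum (fun k => ∫ x in c..d, ‖sliceCoeff f k x‖ ^ 2)
      ((2 * π)⁻¹ * ∫ q in Set.Icc c d ×ˢ Set.Icc 0 (2 * π), f q ^ 2) := by
  have hcoeff := continuous_sliceCoeff hf
  have hpars : ∀ x, HasSum (fun k => ‖sliceCoeff f k x‖ ^ 2)
      ((2 * π)⁻¹ * ∫ y in 0..2 * π, f (x, y) ^ 2) := fun x => by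
    have hfx : Continuous fun y => (f (x, y) : ℂ) := by fun_prop
    have hmem : MemLp (fun y => (f (x, y) : ℂ)) 2 (volume.restrict (Set.Ioc 0 (2 * π))) :=
      (memLp_two_iff_integrable_sq_norm hfx.aestronglyMeasurable).2
        ((hfx.norm.pow 2).integrableOn_Icc.mono_set Set.Ioc_subset_Icc_self)
    simpa [sliceCoeff] using hasSum_sq_fourierCoeffOn two_pi_pos hmem
  have hcont : Continuous fun x => (2 * π)⁻¹ * ∫ y in 0..2 * π, f (x, y) ^ 2 := by
    refine Continuous.mul continuous_const ?_
    refine intervalIntegral.continuous_parametric_intervalIntegral_of_continuous'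
      (f := fun x y => f (x, y) ^ 2) ?_ _ _
    simp only [Function.uncurry_def]
    fun_prop
  have hsum : Summable fun k => ∫ x in c..d, ‖sliceCoeff f k x‖ ^ 2 := by
    refine summable_of_sum_le
      (c := ∫ x in c..d, (2 * π)⁻¹ * ∫ y in 0..2 * π, f (x, y) ^ 2)
      (fun k => intervalIntegral.integral_nonneg hcd fun x _ => by positivity) fun s => ?_
    rw [← intervalIntegral.integral_finsetSum
      (fun k _ => Continuous.intervalIntegrable (by fun_prop) _ _)]
    exact intervalIntegral.integral_mono_on hcd
      (Continuous.intervalIntegrable (by fun_prop) _ _) (hcont.intervalIntegrable _ _)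
      fun x _ => sum_le_hasSum s (fun k _ => by positivity) (hpars x)
  have htot : (2 * π)⁻¹ * ∫ q in Set.Icc c d ×ˢ Set.Icc 0 (2 * π), f q ^ 2
      = ∫ x in c..d, ∑' k, ‖sliceCoeff f k x‖ ^ 2 := by
    simp_rw [fun x => (hpars x).tsum_eq]
    rw [intervalIntegral.integral_const_mul, intervalIntegral.integral_of_le hcd,
      ← integral_Icc_eq_integral_Ioc, Measure.volume_eq_prod, setIntegral_prod]
    · simp_rw [intervalIntegral.integral_of_le two_pi_pos.le, integral_Icc_eq_integral_Ioc]
    · exact (hf.pow 2).continuousOn.integrableOn_compact (isCompact_Icc.prod isCompact_Icc)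
  rw [htot]
  simp only [intervalIntegral.integral_of_le hcd] at hsum ⊢
  refine hasSum_integral_of_summable_integral_norm (fun k => ?_) ?_
  · exact ((hcoeff k).norm.pow 2).integrableOn_Icc.mono_set Set.Ioc_subset_Icc_self
  · simpa using hsum

lemma integral_rect_dy_sq_le {h t : ℝ} (hh : 0 < h) (ht : 0 < t) {u v : ℝ × ℝ → ℝ}
    (hu : ContDiff ℝ 1 u) (hv : ContDiff ℝ 1 v)
    (hup : ∀ x ∈ Ih h, u (x, 0) = u (x, 2 * π)) (hvp : ∀ x ∈ Ih h, v (x, 0) = v (x, 2 * π)) :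
    ∫ q in rect h (2 * π), dy u q ^ 2 ≤
      200 * ((∫ q in rect h (2 * π), dx u q ^ 2) + (∫ q in rect h (2 * π), (dy v q + u q) ^ 2)
        + (∫ q in rect h (2 * π), (dy u q - v q + dx v q) ^ 2)
        + ∫ q in rect h (2 * π), v q ^ 2)
      + 2 * π / h * (t * (∫ q in rect h (2 * π), (dy v q + u q) ^ 2)
        + (∫ q in rect h (2 * π), u q ^ 2) / t) := by
  have cu := hu.continuous
  have cv := hv.continuous
  have cux := continuous_dx hu
  have cuy := continuous_dy hu
  have cvx := continuous_dx hv
  have cvy := continuous_dy hv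
  have hle : 1 - h / 2 ≤ 1 + h / 2 := by linarith
  have hsum : ∀ {f : ℝ × ℝ → ℝ}, Continuous f →
      HasSum (fun k => ∫ x in (1 - h / 2)..(1 + h / 2), ‖sliceCoeff f k x‖ ^ 2)
        ((2 * π)⁻¹ * ∫ q in rect h (2 * π), f q ^ 2) :=
    fun hf => hasSum_integral_norm_sliceCoeff_sq hf hle
  have cE : Continuous fun q => dy v q + u q := cvy.add cu
  have cG : Continuous fun q => dy u q - v q + dx v q := (cuy.sub cv).add cvx
  have hR := (((((hsum cux).add (hsum cE)).add (hsum cG)).add (hsum cv)).mul_left 200).add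
    ((((hsum cE).mul_left t).add ((hsum cu).div_const t)).mul_left (2 * π / h))
  have hmode := hasSum_le (fun k => ?_) (hsum cuy) hR
  · have h2π : 0 < (2 * π)⁻¹ := by positivity
    refine le_of_mul_le_mul_left (hmode.trans_eq ?_) h2π
    ring
  have s1 := continuous_sliceCoeff cu k
  have s2 := continuous_sliceCoeff cv k
  have s3 := continuous_sliceCoeff cux k
  have s4 := continuous_sliceCoeff cvx k
  have s5 := continuous_sliceCoeff cE k
  have s6 := continuous_sliceCoeff cG k
  have hY : ∀ x ∈ Set.uIcc (1 - h / 2) (1 + h / 2),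
      sliceCoeff (dy u) k x = I * (k : ℝ) * sliceCoeff u k x := fun x hx => by
    rw [Set.uIcc_of_le hle] at hx
    simpa using sliceCoeff_dy hu k (hup x hx)
  have hE : ∀ x ∈ Set.uIcc (1 - h / 2) (1 + h / 2), sliceCoeff (fun q => dy v q + u q) k x
      = I * (k : ℝ) * sliceCoeff v k x + sliceCoeff u k x := fun x hx => by
    rw [Set.uIcc_of_le hle] at hx
    rw [sliceCoeff_add cvy cu, sliceCoeff_dy hv k (hvp x hx), ofReal_intCast]
  have hG : ∀ x ∈ Set.uIcc (1 - h / 2) (1 + h / 2),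
      sliceCoeff (fun q => dy u q - v q + dx v q) k x
      = I * (k : ℝ) * sliceCoeff u k x - sliceCoeff v k x + sliceCoeff (dx v) k x :=
    fun x hx => by
      rw [sliceCoeff_add (f := fun q => dy u q - v q) (cuy.sub cv) cvx, sliceCoeff_sub cuy cv, hY x hx]
  have hcollect : 200 * ((∫ x in (1 - h / 2)..(1 + h / 2), ‖sliceCoeff (dx u) k x‖ ^ 2)
        + (∫ x in (1 - h / 2)..(1 + h / 2), ‖sliceCoeff (fun q => dy v q + u q) k x‖ ^ 2)
        + (∫ x in (1 - h / 2)..(1 + h / 2),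
            ‖sliceCoeff (fun q => dy u q - v q + dx v q) k x‖ ^ 2)
        + ∫ x in (1 - h / 2)..(1 + h / 2), ‖sliceCoeff v k x‖ ^ 2)
      + 2 * π / h * (t *
          (∫ x in (1 - h / 2)..(1 + h / 2), ‖sliceCoeff (fun q => dy v q + u q) k x‖ ^ 2)
        + (∫ x in (1 - h / 2)..(1 + h / 2), ‖sliceCoeff u k x‖ ^ 2) / t)
      = ∫ x in (1 - h / 2)..(1 + h / 2),
          (200 * (‖sliceCoeff (dx u) k x‖ ^ 2 + ‖sliceCoeff (fun q => dy v q + u q) k x‖ ^ 2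
            + ‖sliceCoeff (fun q => dy u q - v q + dx v q) k x‖ ^ 2 + ‖sliceCoeff v k x‖ ^ 2)
          + 2 * π / h * (t * ‖sliceCoeff (fun q => dy v q + u q) k x‖ ^ 2
            + ‖sliceCoeff u k x‖ ^ 2 / t)) := by
    simp only [← intervalIntegral.integral_const_mul, ← intervalIntegral.integral_div]
    repeat rw [← intervalIntegral.integral_add (Continuous.intervalIntegrable (by fun_prop) _ _)
      (Continuous.intervalIntegrable (by fun_prop) _ _)]
    simp only [← intervalIntegral.integral_const_mul]
    rw [← intervalIntegral.integral_add (Continuous.intervalIntegrable (by fun_prop) _ _)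
      (Continuous.intervalIntegrable (by fun_prop) _ _)]
  rw [hcollect]
  rcases eq_or_ne k 0 with rfl | hk
  · have : ∫ x in (1 - h / 2)..(1 + h / 2), ‖sliceCoeff (dy u) 0 x‖ ^ 2 = 0 := by
      rw [intervalIntegral.integral_congr (g := fun _ => (0 : ℝ))
        fun x hx => by simp [hY x hx]]
      simp
    rw [this]
    exact intervalIntegral.integral_nonneg hle fun x _ => by positivity
  · have hk1 : 1 ≤ |(k : ℝ)| := by exact_mod_cast Int.one_le_abs hk
    have hend : 1 - h / 2 + h = 1 + h / 2 := by ring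
    have hb := mode_integral_bound hk1 hh ht (1 - h / 2) (hasDerivAt_sliceCoeff hu k)
      (hasDerivAt_sliceCoeff hv k) s3 s4
    rw [hend] at hb
    calc _ = _ := intervalIntegral.integral_congr fun x hx => by
          simp only [hY x hx, norm_mul, norm_I, norm_real, one_mul, mul_pow, Real.norm_eq_abs,
            sq_abs]
      _ ≤ _ := hb
      _ = _ := intervalIntegral.integral_congr fun x hx => by
          simp only [hE x hx, hG x hx]

end

lemma le_add_two_mul_sqrt_mul_sqrt {X A B E U : ℝ} (hB : 0 ≤ B) (hE : 0 ≤ E) (hU : 0 ≤ U)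
    (hX : ∀ t, 0 < t → X ≤ A + B * (t * E + U / t)) :
    X ≤ A + B * (2 * (√E * √U)) := by
  have hlim : Filter.Tendsto (fun ε => A + B * (2 * (√E * √U) + ε * (√E + √U)))
      (nhdsWithin 0 (Set.Ioi 0)) (nhds (A + B * (2 * (√E * √U) + 0 * (√E + √U)))) :=
    (Continuous.tendsto (by fun_prop) 0).mono_left nhdsWithin_le_nhds
  rw [zero_mul, add_zero] at hlim
  refine ge_of_tendsto hlim ?_
  filter_upwards [self_mem_nhdsWithin] with ε (hε : 0 < ε)
  have he := Real.sqrt_nonneg E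
  have hu := Real.sqrt_nonneg U
  refine (hX ((√U + ε) / (√E + ε)) (by positivity)).trans ?_
  gcongr A + B * ?_
  have h1 : (√U + ε) / (√E + ε) * E ≤ (√U + ε) * √E := by
    rw [div_mul_eq_mul_div, div_le_iff₀ (by positivity)]
    nlinarith [Real.sq_sqrt hE, mul_nonneg (mul_nonneg (add_nonneg hu hε.le) he) hε.le]
  have h2 : U / ((√U + ε) / (√E + ε)) ≤ (√E + ε) * √U := by
    rw [div_div_eq_mul_div, div_le_iff₀ (by positivity)]
    nlinarith [Real.sq_sqrt hU, mul_nonneg (mul_nonneg (add_nonneg he hε.le) hu) hε.le]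
  linarith

/-- Second part of the periodic-annulus Korn-type theorem (Theorem 2.5, inequality (2.14)). -/
theorem periodic_annulus_G_bound :
    ∃ σ C₀ : ℝ, 0 < σ ∧ 0 < C₀ ∧ ∀ h : ℝ, 0 < h → h < σ →
      ∀ u v : ℝ × ℝ → ℝ, ContDiff ℝ (⊤ : ℕ∞) u → ContDiff ℝ (⊤ : ℕ∞) v →
      (∀ x ∈ Ih h, u (x, 0) = u (x, 2*π)) →
      (∀ x ∈ Ih h, v (x, 0) = v (x, 2*π)) →
      (∫ q in rect h (2*π),
          ((dx u q)^2 + (dy u q - v q)^2 + (dx v q)^2 + (dy v q + u q)^2))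
        ≤ C₀ * ((∫ q in rect h (2*π),
              ((dx u q)^2 + 2*((dy u q - v q + dx v q)/2)^2 + (dy v q + u q)^2))
            + Real.sqrt (∫ q in rect h (2*π),
                ((dx u q)^2 + 2*((dy u q - v q + dx v q)/2)^2 + (dy v q + u q)^2)) *
              Real.sqrt (∫ q in rect h (2*π), (u q)^2) / h
            + ∫ q in rect h (2*π), (v q)^2) := by
  refine ⟨1, 2500, one_pos, by norm_num, fun h hh _ u v hu' hv' hup hvp => ?_⟩
  have hu : ContDiff ℝ 1 u := hu'.of_le (by exact_mod_cast le_top)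
  have hv : ContDiff ℝ 1 v := hv'.of_le (by exact_mod_cast le_top)
  have cu := hu.continuous
  have cv := hv.continuous
  have cux := continuous_dx hu
  have cuy := continuous_dy hu
  have cvx := continuous_dx hv
  have cvy := continuous_dy hv
  have hInt : ∀ {f : ℝ × ℝ → ℝ}, Continuous f → IntegrableOn f (rect h (2 * π)) :=
    fun hf => hf.continuousOn.integrableOn_compact (isCompact_Icc.prod isCompact_Icc)
  set E := ∫ q in rect h (2 * π),
    ((dx u q)^2 + 2*((dy u q - v q + dx v q)/2)^2 + (dy v q + u q)^2) with hE
  have hE0 : 0 ≤ E := integral_nonneg fun q => by positivity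
  have hU0 : 0 ≤ ∫ q in rect h (2 * π), u q ^ 2 := integral_nonneg fun q => by positivity
  have hV0 : 0 ≤ ∫ q in rect h (2 * π), v q ^ 2 := integral_nonneg fun q => by positivity
  have hBE : ∫ q in rect h (2 * π), (dy v q + u q) ^ 2 ≤ E :=
    integral_mono (hInt (by fun_prop)) (hInt (by fun_prop)) fun q => by
      dsimp only
      linarith [sq_nonneg (dx u q), sq_nonneg ((dy u q - v q + dx v q) / 2)]
  have hABG : (∫ q in rect h (2 * π), dx u q ^ 2) + (∫ q in rect h (2 * π), (dy v q + u q) ^ 2)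
      + (∫ q in rect h (2 * π), (dy u q - v q + dx v q) ^ 2) ≤ 2 * E := by
    rw [hE, ← integral_const_mul, ← integral_add (hInt (by fun_prop)) (hInt (by fun_prop)),
      ← integral_add (hInt (by fun_prop)) (hInt (by fun_prop))]
    refine integral_mono (hInt (by fun_prop)) (hInt (by fun_prop)) fun q => ?_
    dsimp only
    linarith [sq_nonneg (dx u q), sq_nonneg (dy v q + u q)]
  have hG : ∫ q in rect h (2 * π),
        ((dx u q)^2 + (dy u q - v q)^2 + (dx v q)^2 + (dy v q + u q)^2)
      ≤ 4 * E + 6 * (∫ q in rect h (2 * π), dy u q ^ 2) + 6 * ∫ q in rect h (2 * π), v q ^ 2 := by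
    rw [hE, ← integral_const_mul, ← integral_const_mul, ← integral_const_mul,
      ← integral_add (hInt (by fun_prop)) (hInt (by fun_prop)),
      ← integral_add (hInt (by fun_prop)) (hInt (by fun_prop))]
    refine integral_mono (hInt (by fun_prop)) (hInt (by fun_prop)) fun q => ?_
    dsimp only
    linarith [sq_nonneg (dx u q), sq_nonneg (dy v q + u q), sq_nonneg (dy u q + v q),
      sq_nonneg (2 * (dy u q - v q) + dx v q)]
  have hX := le_add_two_mul_sqrt_mul_sqrt (X := ∫ q in rect h (2 * π), dy u q ^ 2)
    (A := 400 * E + 200 * ∫ q in rect h (2 * π), v q ^ 2) (B := 2 * π / h) (by positivity)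
    hE0 hU0 fun t ht => by
      refine (integral_rect_dy_sq_le hh ht hu hv hup hvp).trans ?_
      gcongr
      linarith
  set S := √E * √(∫ q in rect h (2 * π), u q ^ 2)
  have hS : 2 * π / h * (2 * S) ≤ 16 * (S / h) := by
    have : 0 ≤ S / h := by positivity
    calc 2 * π / h * (2 * S) = 4 * π * (S / h) := by ring
      _ ≤ 16 * (S / h) := by
        gcongr
        linarith [Real.pi_le_four]
  have hS0 : 0 ≤ S / h := by positivity
  linarith
end
end

section
/- (Ansatz-free lower bound) Let C_h be the cylindrical shell of thickness h and V_h¹ = {φ ∈ W^{1,2}(C_h;ℝ³) : φ(r,θ,0) = 0, φ_r(r,θ,L) = φ_θ(r,θ,L) = 0}. There exists C(L) > 0 depending only on L such that K(V_h¹) ≥ C(L) h^{3/2}, i.e. ‖∇φ‖² ≤ C(L)⁻¹ h^{−3/2} ‖e(φ)‖² for all φ ∈ V_h¹. -/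
open Real MeasureTheory

noncomputable section

/-- r-partial derivative of a function on (r,θ,z)-space. -/
def dr (f : ℝ × ℝ × ℝ → ℝ) (q : ℝ × ℝ × ℝ) : ℝ := fderiv ℝ f q (1, 0, 0)

/-- θ-partial derivative. -/
def dth (f : ℝ × ℝ × ℝ → ℝ) (q : ℝ × ℝ × ℝ) : ℝ := fderiv ℝ f q (0, 1, 0)

/-- z-partial derivative. -/
def dz (f : ℝ × ℝ × ℝ → ℝ) (q : ℝ × ℝ × ℝ) : ℝ := fderiv ℝ f q (0, 0, 1)

/-- The cylindrical shell C_h (in cylindrical coordinates, with θ ∈ [0,2π]). -/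
def shell (h L : ℝ) : Set (ℝ × ℝ × ℝ) :=
  Set.Icc (1 - h/2) (1 + h/2) ×ˢ Set.Icc 0 (2*π) ×ˢ Set.Icc 0 L

/-- 2π-periodicity in θ. -/
def Periodic3 (f : ℝ × ℝ × ℝ → ℝ) : Prop :=
  ∀ q : ℝ × ℝ × ℝ, f (q.1, q.2.1 + 2*π, q.2.2) = f q

/-- Squared Frobenius norm of the gradient in cylindrical coordinates. -/
def gradSq (fr fθ fz : ℝ × ℝ × ℝ → ℝ) (q : ℝ × ℝ × ℝ) : ℝ :=
  (dr fr q)^2 + ((dth fr q - fθ q)/q.1)^2 + (dz fr q)^2 +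
  (dr fθ q)^2 + ((dth fθ q + fr q)/q.1)^2 + (dz fθ q)^2 +
  (dr fz q)^2 + (dth fz q / q.1)^2 + (dz fz q)^2

/-- Squared Frobenius norm of the symmetrized gradient in cylindrical coordinates. -/
def eSq (fr fθ fz : ℝ × ℝ × ℝ → ℝ) (q : ℝ × ℝ × ℝ) : ℝ :=
  (dr fr q)^2 + ((dth fθ q + fr q)/q.1)^2 + (dz fz q)^2 +
  2*((dr fθ q + (dth fr q - fθ q)/q.1)/2)^2 +
  2*((dz fr q + dr fz q)/2)^2 +
  2*((dz fθ q + dth fz q / q.1)/2)^2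

/-- Squared Frobenius norm of the modified gradient matrix A (1/r factors removed). -/
def ASq (fr fθ fz : ℝ × ℝ × ℝ → ℝ) (q : ℝ × ℝ × ℝ) : ℝ :=
  (dr fr q)^2 + (dth fr q - fθ q)^2 + (dz fr q)^2 +
  (dr fθ q)^2 + (dth fθ q + fr q)^2 + (dz fθ q)^2 +
  (dr fz q)^2 + (dth fz q)^2 + (dz fz q)^2

/-- Squared Frobenius norm of A_sym = (A + Aᵀ)/2. -/
def AsymSq (fr fθ fz : ℝ × ℝ × ℝ → ℝ) (q : ℝ × ℝ × ℝ) : ℝ :=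
  (dr fr q)^2 + (dth fθ q + fr q)^2 + (dz fz q)^2 +
  2*((dr fθ q + dth fr q - fθ q)/2)^2 +
  2*((dz fr q + dr fz q)/2)^2 +
  2*((dz fθ q + dth fz q)/2)^2

/-- Boundary conditions of the space V_h¹: φ = 0 at z = 0, φ_r = φ_θ = 0 at z = L. -/
def BC1 (L : ℝ) (fr fθ fz : ℝ × ℝ × ℝ → ℝ) : Prop :=
  ∀ r θ : ℝ, fr (r, θ, 0) = 0 ∧ fθ (r, θ, 0) = 0 ∧ fz (r, θ, 0) = 0 ∧
    fr (r, θ, L) = 0 ∧ fθ (r, θ, L) = 0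

/-- Boundary conditions of the space V_h²: φ_θ = φ_z = 0 at z = 0 and z = L. -/
def BC2 (L : ℝ) (fr fθ fz : ℝ × ℝ × ℝ → ℝ) : Prop :=
  ∀ r θ : ℝ, fθ (r, θ, 0) = 0 ∧ fz (r, θ, 0) = 0 ∧
    fθ (r, θ, L) = 0 ∧ fz (r, θ, L) = 0

/-- Iterated integral over the rectangle `[0, H] × [0, T]`. -/
def rectIntegral (H T : ℝ) (f : ℝ × ℝ → ℝ) : ℝ := ∫ x in (0 : ℝ)..H, ∫ y in (0 : ℝ)..T, f (x, y)

theorem continuous_inner_integral {f : ℝ × ℝ → ℝ} (hf : Continuous f) (a b : ℝ) :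
    Continuous fun x => ∫ y in a..b, f (x, y) :=
  intervalIntegral.continuous_parametric_intervalIntegral_of_continuous' (f := fun x y => f (x, y))
    (by simpa [Function.uncurry_def] using hf) a b

theorem integral_swap_of_continuous {f : ℝ × ℝ → ℝ} (hf : Continuous f) {a b c d : ℝ}
    (hab : a ≤ b) (hcd : c ≤ d) :
    ∫ x in a..b, ∫ y in c..d, f (x, y) = ∫ y in c..d, ∫ x in a..b, f (x, y) := by
  simp only [intervalIntegral.integral_of_le hab, intervalIntegral.integral_of_le hcd,
    ← integral_Icc_eq_integral_Ioc]
  apply integral_integral_swap (f := fun x y => f (x, y))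
  rw [Measure.prod_restrict]
  exact hf.continuousOn.integrableOn_compact (isCompact_Icc.prod isCompact_Icc)

theorem rectIntegral_mono {H T : ℝ} (hH : 0 ≤ H) (hT : 0 ≤ T) {f g : ℝ × ℝ → ℝ}
    (hf : Continuous f) (hg : Continuous g)
    (h : ∀ x ∈ Set.Icc 0 H, ∀ y ∈ Set.Icc 0 T, f (x, y) ≤ g (x, y)) :
    rectIntegral H T f ≤ rectIntegral H T g := by
  refine intervalIntegral.integral_mono_on hH
    ((continuous_inner_integral hf 0 T).intervalIntegrable _ _)
    ((continuous_inner_integral hg 0 T).intervalIntegrable _ _) fun x hx => ?_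
  exact intervalIntegral.integral_mono_on hT
    (Continuous.intervalIntegrable (by fun_prop) _ _)
    (Continuous.intervalIntegrable (by fun_prop) _ _) fun y hy => h x hx y hy

theorem rectIntegral_add {H T : ℝ} {f g : ℝ × ℝ → ℝ} (hf : Continuous f) (hg : Continuous g) :
    rectIntegral H T (fun q => f q + g q) = rectIntegral H T f + rectIntegral H T g := by
  unfold rectIntegral
  rw [← intervalIntegral.integral_add
    ((continuous_inner_integral hf 0 T).intervalIntegrable _ _)
    ((continuous_inner_integral hg 0 T).intervalIntegrable _ _)]
  congr 1
  ext x
  exact intervalIntegral.integral_add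
    (Continuous.intervalIntegrable (by fun_prop) _ _)
    (Continuous.intervalIntegrable (by fun_prop) _ _)

theorem rectIntegral_const_mul {H T : ℝ} (c : ℝ) (f : ℝ × ℝ → ℝ) :
    rectIntegral H T (fun q => c * f q) = c * rectIntegral H T f := by
  simp [rectIntegral, intervalIntegral.integral_const_mul]

theorem rectIntegral_le_three {H T : ℝ} (hH : 0 ≤ H) (hT : 0 ≤ T) {f g₁ g₂ g₃ : ℝ × ℝ → ℝ}
    (hf : Continuous f) (h₁ : Continuous g₁) (h₂ : Continuous g₂) (h₃ : Continuous g₃)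
    (c₁ c₂ c₃ : ℝ)
    (h : ∀ x ∈ Set.Icc 0 H, ∀ y ∈ Set.Icc 0 T,
      f (x, y) ≤ c₁ * g₁ (x, y) + c₂ * g₂ (x, y) + c₃ * g₃ (x, y)) :
    rectIntegral H T f ≤
      c₁ * rectIntegral H T g₁ + c₂ * rectIntegral H T g₂ + c₃ * rectIntegral H T g₃ := by
  rw [← rectIntegral_const_mul, ← rectIntegral_const_mul, ← rectIntegral_const_mul,
    ← rectIntegral_add (by fun_prop) (by fun_prop), ← rectIntegral_add (by fun_prop) (by fun_prop)]
  exact rectIntegral_mono hH hT hf (by fun_prop) h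

theorem rectIntegral_le_two {H T : ℝ} (hH : 0 ≤ H) (hT : 0 ≤ T) {f g₁ g₂ : ℝ × ℝ → ℝ}
    (hf : Continuous f) (h₁ : Continuous g₁) (h₂ : Continuous g₂) (c₁ c₂ : ℝ)
    (h : ∀ x ∈ Set.Icc 0 H, ∀ y ∈ Set.Icc 0 T, f (x, y) ≤ c₁ * g₁ (x, y) + c₂ * g₂ (x, y)) :
    rectIntegral H T f ≤ c₁ * rectIntegral H T g₁ + c₂ * rectIntegral H T g₂ := by
  have := rectIntegral_le_three hH hT hf h₁ h₂ h₂ c₁ c₂ 0 (by simpa using h)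
  simpa using this

theorem rectIntegral_deriv_snd {H T : ℝ} {g gy : ℝ × ℝ → ℝ} (hgy : Continuous gy)
    (hg : ∀ x y, HasDerivAt (fun t => g (x, t)) (gy (x, y)) y)
    (hb : ∀ x, g (x, 0) = g (x, T)) : rectIntegral H T gy = 0 := by
  unfold rectIntegral
  have : ∀ x, ∫ y in (0 : ℝ)..T, gy (x, y) = 0 := fun x => by
    rw [intervalIntegral.integral_eq_sub_of_hasDerivAt (fun y _ => hg x y)
      (Continuous.intervalIntegrable (by fun_prop) _ _), hb, sub_self]
  simp [this]

theorem rectIntegral_deriv_fst {H T : ℝ} (hH : 0 ≤ H) (hT : 0 ≤ T) {g gx : ℝ × ℝ → ℝ}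
    (hgx : Continuous gx) (hg : ∀ x y, HasDerivAt (fun t => g (t, y)) (gx (x, y)) x) :
    rectIntegral H T gx = ∫ y in (0 : ℝ)..T, (g (H, y) - g (0, y)) := by
  unfold rectIntegral
  rw [integral_swap_of_continuous hgx hH hT]
  congr 1
  ext y
  exact intervalIntegral.integral_eq_sub_of_hasDerivAt (fun x _ => hg x y)
      (Continuous.intervalIntegrable (by fun_prop) _ _)

theorem rectIntegral_half_le {H T : ℝ} (hH : 0 ≤ H) (hT : 0 ≤ T) {f : ℝ × ℝ → ℝ}
    (hf : Continuous f) (h0 : ∀ q, 0 ≤ f q) :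
    rectIntegral (H / 2) T f ≤ rectIntegral H T f := by
  refine intervalIntegral.integral_mono_interval le_rfl (by linarith) (by linarith) ?_
    ((continuous_inner_integral hf 0 T).intervalIntegrable _ _)
  exact Filter.Eventually.of_forall fun x =>
    intervalIntegral.integral_nonneg hT fun y _ => h0 _

theorem rectIntegral_comp_two_mul {H T : ℝ} (f : ℝ × ℝ → ℝ) :
    rectIntegral (H / 2) T (fun q => f (2 * q.1, q.2)) = 1 / 2 * rectIntegral H T f := by
  unfold rectIntegral
  have := intervalIntegral.integral_comp_mul_left (a := 0) (b := H / 2)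
    (fun x => ∫ y in (0 : ℝ)..T, f (x, y)) (two_ne_zero (α := ℝ))
  simp only [this, mul_zero, mul_div_cancel₀ H (two_ne_zero (α := ℝ))]
  simp

theorem rectIntegral_reflect {H T : ℝ} (f : ℝ × ℝ → ℝ) :
    rectIntegral H T (fun q => f (H - q.1, q.2)) = rectIntegral H T f := by
  unfold rectIntegral
  simpa using intervalIntegral.integral_comp_sub_left (a := 0) (b := H)
    (fun x => ∫ y in (0 : ℝ)..T, f (x, y)) H

/-- A planar displacement `(u, v)` on a strip, recorded through `u` and the partial derivatives
of `u` and `v`; the boundary terms of an integration by parts in `y` on `[0, T]` cancel. -/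
structure StripField (T : ℝ) (u ux uy vx vy vxy : ℝ × ℝ → ℝ) : Prop where
  cont_u : Continuous u
  cont_ux : Continuous ux
  cont_uy : Continuous uy
  cont_vx : Continuous vx
  cont_vy : Continuous vy
  cont_vxy : Continuous vxy
  deriv_ux : ∀ x y, HasDerivAt (fun t => u (t, y)) (ux (x, y)) x
  deriv_uy : ∀ x y, HasDerivAt (fun t => u (x, t)) (uy (x, y)) y
  deriv_vxy : ∀ x y, HasDerivAt (fun t => vx (x, t)) (vxy (x, y)) y
  deriv_vyx : ∀ x y, HasDerivAt (fun t => vy (t, y)) (vxy (x, y)) x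
  boundary : ∀ x x', u (x, 0) * vx (x', 0) = u (x, T) * vx (x', T)

theorem weighted_mul_le {δ : ℝ} (hδ : 0 < δ) (a b : ℝ) :
    a * b ≤ δ * a ^ 2 / 2 + b ^ 2 / (2 * δ) := by
  have h : δ * a ^ 2 / 2 + b ^ 2 / (2 * δ) - a * b = (δ * a - b) ^ 2 / (2 * δ) := by
    field_simp
    ring
  have : 0 ≤ (δ * a - b) ^ 2 / (2 * δ) := by positivity
  linarith

theorem cutoff_pointwise {K δ κ ρ p px py qx E : ℝ} (hK : 0 < K) (hK1 : K ≤ 1) (hδ : 0 < δ)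
    (hκ : |κ| ≤ 1) (hρ0 : 0 ≤ ρ) (hρ1 : ρ ≤ 1) :
    -(1 / K) * (p * E) + ρ * (px * E + κ * p * px - py * qx) ≤
      (qx - py) ^ 2 + (1 + 1 / (δ * K)) * (E ^ 2 + px ^ 2) + δ / K * p ^ 2 := by
  have hi : 1 ≤ 1 / K := by rw [le_div_iff₀ hK]; linarith
  have h1 := weighted_mul_le hδ p (-E)
  have h2 := weighted_mul_le hδ |p| |px|
  rw [sq_abs, sq_abs] at h2
  have e1 : 1 / K * (δ * p ^ 2 / 2 + E ^ 2 / (2 * δ)) + 1 / K * (δ * p ^ 2 / 2 + px ^ 2 / (2 * δ))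
      ≤ 1 / (δ * K) * (E ^ 2 + px ^ 2) + δ / K * p ^ 2 := by
    have : 1 / K * (δ * p ^ 2 / 2 + E ^ 2 / (2 * δ)) + 1 / K * (δ * p ^ 2 / 2 + px ^ 2 / (2 * δ))
      = 1 / 2 * (1 / (δ * K) * (E ^ 2 + px ^ 2)) + δ / K * p ^ 2 := by
      field_simp
      ring
    rw [this]
    have : 0 ≤ 1 / (δ * K) * (E ^ 2 + px ^ 2) := by positivity
    linarith
  have t1 : -(1 / K) * (p * E) ≤ 1 / K * (δ * p ^ 2 / 2 + E ^ 2 / (2 * δ)) := by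
    have := mul_le_mul_of_nonneg_left h1 (by positivity : 0 ≤ 1 / K)
    rw [neg_sq] at this
    linarith
  have t2 : ρ * (κ * p * px) ≤ 1 / K * (δ * p ^ 2 / 2 + px ^ 2 / (2 * δ)) := by
    have hn : 0 ≤ |p| * |px| := by positivity
    calc ρ * (κ * p * px) ≤ |ρ * (κ * p * px)| := le_abs_self _
      _ = ρ * |κ| * (|p| * |px|) := by rw [abs_mul, abs_mul, abs_mul, abs_of_nonneg hρ0]; ring
      _ ≤ 1 * (|p| * |px|) := by
        apply mul_le_mul_of_nonneg_right _ hn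
        exact mul_le_one₀ hρ1 (abs_nonneg _) hκ
      _ ≤ 1 / K * (|p| * |px|) := mul_le_mul_of_nonneg_right hi hn
      _ ≤ _ := mul_le_mul_of_nonneg_left h2 (by positivity)
  have t3 : ρ * (px * E) ≤ E ^ 2 + px ^ 2 := by
    nlinarith [mul_nonneg hρ0 (sq_nonneg (px - E)),
      mul_nonneg (sub_nonneg.2 hρ1) (add_nonneg (sq_nonneg px) (sq_nonneg E)),
      sq_nonneg px, sq_nonneg E]
  have t4 : ρ * (-(py * qx)) ≤ (qx - py) ^ 2 := by
    nlinarith [mul_nonneg hρ0 (sq_nonneg (qx + py)),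
      mul_nonneg (sub_nonneg.2 hρ1) (sq_nonneg (qx - py)), sq_nonneg (qx - py)]
  linarith

/-- Strain energy density of a strip field, with the weights of the Korn estimate. -/
def stripEnergy (H δ κ : ℝ) (u ux uy vx vy : ℝ × ℝ → ℝ) (q : ℝ × ℝ) : ℝ :=
  (vx q + uy q) ^ 2 + (1 + 1 / (δ * H)) * ((vy q + κ * u q) ^ 2 + ux q ^ 2) + δ / H * u q ^ 2

section
variable {T κ δ : ℝ} {u ux uy vx vy vxy : ℝ × ℝ → ℝ}

theorem StripField.cutoff_boundary_le {K : ℝ} (S : StripField T u ux uy vx vy vxy)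
    (hT : 0 ≤ T) (hK : 0 < K) (hK1 : K ≤ 1) (hδ : 0 < δ) (hκ : |κ| ≤ 1) :
    -(∫ y in (0 : ℝ)..T, u (0, y) * (vy (0, y) + κ * u (0, y))) ≤
      rectIntegral K T fun q => (vx q - uy q) ^ 2 +
        (1 + 1 / (δ * K)) * ((vy q + κ * u q) ^ 2 + ux q ^ 2) + δ / K * u q ^ 2 := by
  obtain ⟨c1, c2, c3, c4, c5, c6, d1, d2, d3, d4, hb⟩ := S
  have cD1 : Continuous fun q : ℝ × ℝ => -(1 / K) * (u q * (vy q + κ * u q)) +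
      (1 - q.1 / K) * (ux q * (vy q + κ * u q) + u q * (vxy q + κ * ux q)) := by fun_prop
  have cD2 : Continuous fun q : ℝ × ℝ => (1 - q.1 / K) * (uy q * vx q + u q * vxy q) := by
    fun_prop
  have I1 := rectIntegral_deriv_fst (H := K) (T := T) hK.le hT
    (g := fun q => (1 - q.1 / K) * (u q * (vy q + κ * u q))) cD1 (fun x y => by
      have h := (((hasDerivAt_id x).div_const K).const_sub 1).mul
        ((d1 x y).mul ((d4 x y).add ((d1 x y).const_mul κ)))
      refine h.congr_deriv ?_
      simp)
  have I2 := rectIntegral_deriv_snd (H := K) (T := T)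
    (g := fun q => (1 - q.1 / K) * (u q * vx q)) cD2 (fun x y =>
      ((d2 x y).mul (d3 x y)).const_mul (1 - x / K)) (fun x => by simp only [hb])
  have hle := rectIntegral_le_two (H := K) (T := T) hK.le hT cD1
    (by fun_prop : Continuous fun q => (vx q - uy q) ^ 2 +
        (1 + 1 / (δ * K)) * ((vy q + κ * u q) ^ 2 + ux q ^ 2) + δ / K * u q ^ 2) cD2 1 1
    (fun x hx y _ => by
      have := cutoff_pointwise (ρ := 1 - x / K) (p := u (x, y)) (px := ux (x, y)) (py := uy (x, y))
        (qx := vx (x, y)) (E := vy (x, y) + κ * u (x, y)) hK hK1 hδ hκ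
        (by rw [sub_nonneg, div_le_one hK]; exact hx.2)
        (by have := div_nonneg hx.1 hK.le; linarith)
      simp only
      linarith)
  rw [I2, I1] at hle
  simpa [hK.ne', div_self] using hle

theorem rectIntegral_poincare {K : ℝ} {g gx : ℝ × ℝ → ℝ} (hT : 0 ≤ T) (hK : 0 ≤ K) (hK1 : K ≤ 1)
    (cg : Continuous g) (cgx : Continuous gx)
    (hg : ∀ x y, HasDerivAt (fun t => g (t, y)) (gx (x, y)) x) (h0 : ∀ y, g (0, y) = 0) :
    rectIntegral K T (fun q => g q ^ 2) ≤ 4 * rectIntegral K T (fun q => gx q ^ 2) := by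
  have cD : Continuous fun q : ℝ × ℝ => g q ^ 2 + (q.1 - K) * (2 * g q * gx q) := by fun_prop
  have I1 := rectIntegral_deriv_fst (H := K) (T := T) hK hT
    (g := fun q => (q.1 - K) * g q ^ 2) cD (fun x y => by
      have h := ((hasDerivAt_id x).sub_const K).mul ((hg x y).pow 2)
      refine h.congr_deriv ?_
      simp)
  have hle := rectIntegral_le_two (H := K) (T := T) hK hT
    (by fun_prop : Continuous fun q => g q ^ 2) cD (by fun_prop : Continuous fun q => gx q ^ 2)
    2 4 (fun x hx y _ => by
      simp only
      have h1 : 0 ≤ 1 - (K - x) ^ 2 := by nlinarith [hx.1, hx.2]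
      nlinarith [sq_nonneg (g (x, y) - 2 * (K - x) * gx (x, y)),
        mul_nonneg h1 (sq_nonneg (gx (x, y)))])
  rw [I1] at hle
  simpa [h0] using hle

theorem hasDerivAt_comp_two_mul {f : ℝ → ℝ} {f' x : ℝ} (h : HasDerivAt f f' (2 * x)) :
    HasDerivAt (fun t => f (2 * t)) (2 * f') x := by
  have := h.comp x ((hasDerivAt_id x).const_mul 2)
  simpa [mul_comm, Function.comp_def] using this

/-- The reflected field of Nitsche's extension across `x = 0`. -/
theorem StripField.nitsche (S : StripField T u ux uy vx vy vxy) :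
    StripField T (fun q => -3 * u q + 4 * u (2 * q.1, q.2))
      (fun q => -3 * ux q + 8 * ux (2 * q.1, q.2)) (fun q => -3 * uy q + 4 * uy (2 * q.1, q.2))
      (fun q => 3 * vx q - 4 * vx (2 * q.1, q.2)) (fun q => 3 * vy q - 2 * vy (2 * q.1, q.2))
      (fun q => 3 * vxy q - 4 * vxy (2 * q.1, q.2)) := by
  obtain ⟨c1, c2, c3, c4, c5, c6, d1, d2, d3, d4, hb⟩ := S
  refine ⟨by fun_prop, by fun_prop, by fun_prop, by fun_prop, by fun_prop, by fun_prop,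
    fun x y => ?_, fun x y => ?_, fun x y => ?_, fun x y => ?_, fun x x' => ?_⟩
  · exact (((d1 x y).const_mul (-3)).add
      ((hasDerivAt_comp_two_mul (d1 (2 * x) y)).const_mul 4)).congr_deriv (by ring)
  · exact ((d2 x y).const_mul (-3)).add ((d2 (2 * x) y).const_mul 4)
  · exact ((d3 x y).const_mul 3).sub ((d3 (2 * x) y).const_mul 4)
  · exact (((d4 x y).const_mul 3).sub
      ((hasDerivAt_comp_two_mul (d4 (2 * x) y)).const_mul 2)).congr_deriv (by ring)
  · simp only
    linear_combination -9 * hb x x' + 12 * hb x (2 * x') + 12 * hb (2 * x) x' -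
      16 * hb (2 * x) (2 * x')

theorem nitsche_pointwise {a b e3 e3' ux ux' E E' u u' : ℝ} (ha : 0 ≤ a) (hb : 0 ≤ b) :
    (3 * e3 - 4 * e3') ^ 2 + (1 + 2 * a) * ((3 * E - 2 * E' + 6 * κ * (u' - u)) ^ 2 +
      (-3 * ux + 8 * ux') ^ 2) + 2 * b * (-3 * u + 4 * u') ^ 2 ≤
    100 * (e3 ^ 2 + (1 + a) * (E ^ 2 + ux ^ 2) + b * u ^ 2) +
    300 * (e3' ^ 2 + (1 + a) * (E' ^ 2 + ux' ^ 2) + b * u' ^ 2) +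
    108 * κ ^ 2 * (1 + 2 * a) * (u' - u) ^ 2 := by
  have h1 : (3 * e3 - 4 * e3') ^ 2 ≤ 18 * e3 ^ 2 + 32 * e3' ^ 2 := by
    nlinarith [sq_nonneg (3 * e3 + 4 * e3')]
  have h2 : (-3 * ux + 8 * ux') ^ 2 ≤ 18 * ux ^ 2 + 128 * ux' ^ 2 := by
    nlinarith [sq_nonneg (3 * ux + 8 * ux')]
  have h3 : (-3 * u + 4 * u') ^ 2 ≤ 18 * u ^ 2 + 32 * u' ^ 2 := by
    nlinarith [sq_nonneg (3 * u + 4 * u')]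
  have h4 : (3 * E - 2 * E' + 6 * κ * (u' - u)) ^ 2 ≤
      27 * E ^ 2 + 12 * E' ^ 2 + 108 * κ ^ 2 * (u' - u) ^ 2 := by
    nlinarith [sq_nonneg (3 * E + 2 * E'), sq_nonneg (3 * E - 6 * κ * (u' - u)),
      sq_nonneg (2 * E' + 6 * κ * (u' - u))]
  have h5 := mul_le_mul_of_nonneg_left (add_le_add h4 h2) (by positivity : 0 ≤ 1 + 2 * a)
  have h6 := mul_le_mul_of_nonneg_left h3 (by positivity : 0 ≤ 2 * b)
  nlinarith [mul_nonneg ha (sq_nonneg E), mul_nonneg ha (sq_nonneg E'), mul_nonneg ha (sq_nonneg ux),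
    mul_nonneg ha (sq_nonneg ux'), mul_nonneg hb (sq_nonneg u), mul_nonneg hb (sq_nonneg u'),
    sq_nonneg E, sq_nonneg E', sq_nonneg ux, sq_nonneg ux', sq_nonneg e3, sq_nonneg e3']

theorem StripField.continuous_energy (S : StripField T u ux uy vx vy vxy) (H : ℝ) :
    Continuous (stripEnergy H δ κ u ux uy vx vy) := by
  obtain ⟨c1, c2, c3, c4, c5, c6, -⟩ := S
  unfold stripEnergy
  fun_prop

theorem stripEnergy_nonneg {H : ℝ} (hH : 0 < H) (hδ : 0 < δ) (q : ℝ × ℝ) :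
    0 ≤ stripEnergy H δ κ u ux uy vx vy q := by
  unfold stripEnergy
  positivity

theorem sq_le_stripEnergy {H : ℝ} (hH : 0 < H) (hδ : 0 < δ) (q : ℝ × ℝ) :
    (1 + 1 / (δ * H)) * ux q ^ 2 ≤ stripEnergy H δ κ u ux uy vx vy q := by
  unfold stripEnergy
  have h1 : 0 ≤ (1 + 1 / (δ * H)) * (vy q + κ * u q) ^ 2 := by positivity
  have h2 : 0 ≤ δ / H * u q ^ 2 := by positivity
  nlinarith [sq_nonneg (vx q + uy q)]

theorem StripField.left_boundary_le {H : ℝ} (S : StripField T u ux uy vx vy vxy)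
    (hT : 0 ≤ T) (hH : 0 < H) (hH2 : H ≤ 2) (hδ : 0 < δ) (hκ : |κ| ≤ 1) :
    -(∫ y in (0 : ℝ)..T, u (0, y) * (vy (0, y) + κ * u (0, y))) ≤
      20000 * rectIntegral H T (stripEnergy H δ κ u ux uy vx vy) := by
  have hK : 0 < H / 2 := by positivity
  have hA := S.nitsche.cutoff_boundary_le hT hK (by linarith) hδ hκ
  have hcu := S.cont_u
  have hcux := S.cont_ux
  have cW : Continuous (stripEnergy H δ κ u ux uy vx vy) := S.continuous_energy H
  obtain ⟨-, -, c3, c4, c5, -⟩ := id S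
  set W := stripEnergy H δ κ u ux uy vx vy with hW
  have hL : (∫ y in (0 : ℝ)..T, u (0, y) * (vy (0, y) + κ * u (0, y))) =
      ∫ y in (0 : ℝ)..T, (-3 * u (0, y) + 4 * u (2 * 0, y)) * (3 * vy (0, y) - 2 * vy (2 * 0, y) +
        κ * (-3 * u (0, y) + 4 * u (2 * 0, y))) := by
    congr 1
    ext y
    simp only [mul_zero]
    ring
  simp only at hA
  rw [← hL] at hA
  set a := 1 / (δ * H) with ha
  have ha0 : 0 ≤ a := by positivity
  have hκ2 : κ ^ 2 ≤ 1 := by rw [← sq_abs]; exact pow_le_one₀ (abs_nonneg _) hκ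
  have haK : 1 / (δ * (H / 2)) = 2 * a := by rw [ha]; field_simp
  have hbK : δ / (H / 2) = 2 * (δ / H) := by field_simp
  have cg2 : Continuous fun q : ℝ × ℝ => (u (2 * q.1, q.2) - u q) ^ 2 := by fun_prop
  have cW2 : Continuous fun q : ℝ × ℝ => W (2 * q.1, q.2) := by fun_prop
  have hB := rectIntegral_le_three (H := H / 2) (T := T) hK.le hT
    (by fun_prop : Continuous fun q : ℝ × ℝ =>
      ((3 * vx q - 4 * vx (2 * q.1, q.2)) - (-3 * uy q + 4 * uy (2 * q.1, q.2))) ^ 2 +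
        (1 + 1 / (δ * (H / 2))) * ((3 * vy q - 2 * vy (2 * q.1, q.2) +
          κ * (-3 * u q + 4 * u (2 * q.1, q.2))) ^ 2 + (-3 * ux q + 8 * ux (2 * q.1, q.2)) ^ 2) +
        δ / (H / 2) * (-3 * u q + 4 * u (2 * q.1, q.2)) ^ 2)
    cW cW2 cg2 100 300 (108 * (1 + 2 * a))
    (fun x _ y _ => by
      have := nitsche_pointwise (κ := κ) (e3 := vx (x, y) + uy (x, y))
        (e3' := vx (2 * x, y) + uy (2 * x, y)) (ux := ux (x, y)) (ux' := ux (2 * x, y))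
        (E := vy (x, y) + κ * u (x, y)) (E' := vy (2 * x, y) + κ * u (2 * x, y))
        (u := u (x, y)) (u' := u (2 * x, y)) ha0 (by positivity : 0 ≤ δ / H)
      rw [haK, hbK]
      have h2 : 108 * κ ^ 2 * (1 + 2 * a) * (u (2 * x, y) - u (x, y)) ^ 2 ≤
          108 * (1 + 2 * a) * (u (2 * x, y) - u (x, y)) ^ 2 := by
        have : 0 ≤ 108 * (1 + 2 * a) * (u (2 * x, y) - u (x, y)) ^ 2 := by positivity
        nlinarith
      simp only [hW, stripEnergy, ← ha]
      refine le_trans (le_of_eq ?_) (this.trans (add_le_add le_rfl h2))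
      ring)
  rw [rectIntegral_comp_two_mul] at hB
  have hP := rectIntegral_poincare (K := H / 2) (g := fun q => u (2 * q.1, q.2) - u q)
    (gx := fun q => 2 * ux (2 * q.1, q.2) - ux q) hT hK.le (by linarith) (by fun_prop)
    (by fun_prop)
    (fun x y => (hasDerivAt_comp_two_mul (S.deriv_ux (2 * x) y)).sub (S.deriv_ux x y)) (by simp)
  have hQ := rectIntegral_le_two (H := H / 2) (T := T) hK.le hT
    ((by fun_prop : Continuous fun q : ℝ × ℝ =>
      (2 * ux (2 * q.1, q.2) - ux q) ^ 2).const_mul (1 + 2 * a))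
    cW cW2 4 16 (fun x _ y _ => by
      have h1 := sq_le_stripEnergy (H := H) (κ := κ) (u := u) (ux := ux) (uy := uy) (vx := vx)
        (vy := vy) hH hδ (x, y)
      have h2 := sq_le_stripEnergy (H := H) (κ := κ) (u := u) (ux := ux) (uy := uy) (vx := vx)
        (vy := vy) hH hδ (2 * x, y)
      rw [← ha, ← hW] at h1 h2
      have h3 : (2 * ux (2 * x, y) - ux (x, y)) ^ 2 ≤ 8 * ux (2 * x, y) ^ 2 + 2 * ux (x, y) ^ 2 := by
        nlinarith [sq_nonneg (2 * ux (2 * x, y) + ux (x, y))]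
      have h4 := mul_le_mul_of_nonneg_left h3 (by positivity : 0 ≤ 1 + 2 * a)
      simp only
      nlinarith [sq_nonneg (ux (x, y)), sq_nonneg (ux (2 * x, y))])
  rw [rectIntegral_const_mul, rectIntegral_comp_two_mul] at hQ
  have hHalf := rectIntegral_half_le hH.le hT cW (fun q => stripEnergy_nonneg hH hδ q)
  have hW0 : 0 ≤ rectIntegral H T W :=
    intervalIntegral.integral_nonneg hH.le fun x _ => intervalIntegral.integral_nonneg hT
      fun y _ => stripEnergy_nonneg hH hδ _
  have hP' := mul_le_mul_of_nonneg_left hP (by positivity : 0 ≤ 108 * (1 + 2 * a))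
  refine hA.trans (hB.trans ?_)
  nlinarith

theorem StripField.reflect (S : StripField T u ux uy vx vy vxy) (H : ℝ) :
    StripField T (fun q => -u (H - q.1, q.2)) (fun q => ux (H - q.1, q.2))
      (fun q => -uy (H - q.1, q.2)) (fun q => -vx (H - q.1, q.2)) (fun q => vy (H - q.1, q.2))
      (fun q => -vxy (H - q.1, q.2)) := by
  obtain ⟨c1, c2, c3, c4, c5, c6, d1, d2, d3, d4, hb⟩ := S
  have key : ∀ (f : ℝ → ℝ) (f' x : ℝ), HasDerivAt f f' (H - x) →
      HasDerivAt (fun t => f (H - t)) (-f') x := fun f f' x h => by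
    have := h.comp x ((hasDerivAt_id x).const_sub H)
    simpa [Function.comp_def] using this
  refine ⟨by fun_prop, by fun_prop, by fun_prop, by fun_prop, by fun_prop, by fun_prop,
    fun x y => ?_, fun x y => ?_, fun x y => ?_, fun x y => ?_, fun x x' => ?_⟩
  · simpa using! (key _ _ _ (d1 (H - x) y)).neg
  · exact (d2 (H - x) y).neg
  · exact (d3 (H - x) y).neg
  · exact key _ _ _ (d4 (H - x) y)
  · simpa using hb (H - x) (H - x')

/-- The first-and-a-half Korn inequality on a thin strip. -/
theorem StripField.korn {H : ℝ} (S : StripField T u ux uy vx vy vxy)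
    (hT : 0 ≤ T) (hH : 0 < H) (hH2 : H ≤ 2) (hδ : 0 < δ) (hκ : |κ| ≤ 1) :
    rectIntegral H T (fun q => uy q ^ 2) ≤
      100000 * rectIntegral H T (stripEnergy H δ κ u ux uy vx vy) := by
  have hL := S.left_boundary_le hT hH hH2 hδ hκ
  have hR := (S.reflect H).left_boundary_le hT hH hH2 hδ (by rwa [abs_neg] : |-κ| ≤ 1)
  have hE : (stripEnergy H δ (-κ) (fun q => -u (H - q.1, q.2)) (fun q => ux (H - q.1, q.2))
      (fun q => -uy (H - q.1, q.2)) (fun q => -vx (H - q.1, q.2)) (fun q => vy (H - q.1, q.2))) =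
      fun q => stripEnergy H δ κ u ux uy vx vy (H - q.1, q.2) := by
    ext q
    simp only [stripEnergy]
    ring
  rw [hE, rectIntegral_reflect] at hR
  have hW0 : 0 ≤ rectIntegral H T (stripEnergy H δ κ u ux uy vx vy) :=
    intervalIntegral.integral_nonneg hH.le fun x _ => intervalIntegral.integral_nonneg hT
      fun y _ => stripEnergy_nonneg hH hδ _
  have cW : Continuous (stripEnergy H δ κ u ux uy vx vy) := S.continuous_energy H
  obtain ⟨c1, c2, c3, c4, c5, c6, d1, d2, d3, d4, hb⟩ := S
  have cD1 : Continuous fun q : ℝ × ℝ =>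
      ux q * (vy q + κ * u q) + u q * (vxy q + κ * ux q) := by fun_prop
  have cD2 : Continuous fun q : ℝ × ℝ => uy q * vx q + u q * vxy q := by fun_prop
  have I1 := rectIntegral_deriv_fst (H := H) (T := T) hH.le hT
    (g := fun q => u q * (vy q + κ * u q)) cD1 (fun x y =>
      (d1 x y).mul ((d4 x y).add ((d1 x y).const_mul κ)))
  have I2 := rectIntegral_deriv_snd (H := H) (T := T)
    (g := fun q => u q * vx q) cD2 (fun x y => (d2 x y).mul (d3 x y)) (fun x => hb x x)
  have cuy : Continuous fun q => uy q ^ 2 := by fun_prop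
  have hle := rectIntegral_le_three (H := H) (T := T) hH.le hT cuy cD1 cD2 cW 2 (-2) 2 (fun x _ y _ => by
      simp only [stripEnergy]
      have hi : 1 ≤ 2 / H := by rw [le_div_iff₀ hH]; linarith
      have h2 := weighted_mul_le hδ |u (x, y)| |ux (x, y)|
      rw [sq_abs, sq_abs] at h2
      have hn : 0 ≤ |u (x, y)| * |ux (x, y)| := by positivity
      have t : -(κ * (u (x, y) * ux (x, y))) ≤
          δ / H * u (x, y) ^ 2 + 1 / (δ * H) * ux (x, y) ^ 2 := by
        calc -(κ * (u (x, y) * ux (x, y))) ≤ |κ * (u (x, y) * ux (x, y))| := neg_le_abs _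
          _ = |κ| * (|u (x, y)| * |ux (x, y)|) := by rw [abs_mul, abs_mul]
          _ ≤ 1 * (|u (x, y)| * |ux (x, y)|) := mul_le_mul_of_nonneg_right hκ hn
          _ ≤ 2 / H * (|u (x, y)| * |ux (x, y)|) := mul_le_mul_of_nonneg_right hi hn
          _ ≤ 2 / H * (δ * u (x, y) ^ 2 / 2 + ux (x, y) ^ 2 / (2 * δ)) :=
            mul_le_mul_of_nonneg_left h2 (by positivity)
          _ = _ := by field_simp
      have s : 0 ≤ 1 / (δ * H) * (vy (x, y) + κ * u (x, y)) ^ 2 := by positivity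
      nlinarith [sq_nonneg (ux (x, y) - (vy (x, y) + κ * u (x, y))),
        sq_nonneg (ux (x, y) + (vy (x, y) + κ * u (x, y))),
        sq_nonneg (uy (x, y) - (vx (x, y) + uy (x, y))), sq_nonneg (vx (x, y) + uy (x, y)),
        sq_nonneg (ux (x, y)), sq_nonneg (vy (x, y) + κ * u (x, y))])
  rw [I2, I1, intervalIntegral.integral_sub
      (Continuous.intervalIntegrable (by fun_prop) _ _)
      (Continuous.intervalIntegrable (by fun_prop) _ _)] at hle
  have hR' : (∫ y in (0 : ℝ)..T, u (H, y) * (vy (H, y) + κ * u (H, y))) =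
      -(∫ y in (0 : ℝ)..T, -u (H - 0, y) * (vy (H - 0, y) + -κ * -u (H - 0, y))) := by
    rw [← intervalIntegral.integral_neg]
    congr 1
    ext y
    simp
  simp only at hR
  rw [← hR'] at hR
  linarith

end

/-- Elimination of `F`, `V` and `W` from the system of energy estimates; here `k = h ^ (-1/2)`. -/
theorem energy_elimination {M c k X F V W U : ℝ} (hM : 0 ≤ M) (hc : 1 ≤ c) (hk : 1 ≤ k)
    (hX : 0 ≤ X) (hF : 0 ≤ F) (hV : 0 ≤ V)
    (hW : ∀ η, 0 < η → W ≤ (4 + 2 / η) * X + 2 * η * F) (hVW : V ≤ M * W)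
    (hU : U ≤ c * (k ^ 3 * X + V + k * F))
    (hFU : ∀ τ, 0 < τ → F ≤ 4 / 3 * X + 4 * τ / 3 * U + 1 / (3 * τ) * V) :
    F ≤ (5 + 9 * c * M * (4 + 24 * c * (M + 1))) * (k ^ 2 * X) := by
  have hk0 : 0 < k := by linarith
  have hc0 : 0 < c := by linarith
  have hk2 : 1 ≤ k ^ 2 := one_le_pow₀ hk
  have h1 := hFU (1 / (8 * c * k)) (by positivity)
  have h2 := hW (1 / (12 * c * (M + 1) * k)) (by positivity)
  have e1 : 4 * (1 / (8 * c * k)) / 3 * U ≤ 1 / 6 * (k ^ 2 * X) + 1 / 6 * V + 1 / 6 * F := by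
    calc 4 * (1 / (8 * c * k)) / 3 * U ≤
        4 * (1 / (8 * c * k)) / 3 * (c * (k ^ 3 * X + V + k * F)) :=
          mul_le_mul_of_nonneg_left hU (by positivity)
      _ = 1 / 6 * (k ^ 2 * X) + 1 / 6 * (V / k) + 1 / 6 * F := by
        field_simp
        ring
      _ ≤ _ := by
        have := div_le_self hV hk
        linarith
  have e2 : 1 / (3 * (1 / (8 * c * k))) * V = 8 / 3 * (c * k * V) := by
    field_simp
  have e3 : V ≤ c * k * V := by
    have : 1 ≤ c * k := one_le_mul_of_one_le_of_one_le hc hk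
    nlinarith
  have e4 : X ≤ k ^ 2 * X := by nlinarith
  have e5 : c * k * V ≤ c * M * (4 + 24 * c * (M + 1)) * (k ^ 2 * X) + 1 / 6 * F := by
    have hkk : k ≤ k ^ 2 := by nlinarith
    calc c * k * V ≤ c * k * (M * ((4 + 2 / (1 / (12 * c * (M + 1) * k))) * X +
          2 * (1 / (12 * c * (M + 1) * k)) * F)) := by
          gcongr
          exact hVW.trans (mul_le_mul_of_nonneg_left h2 hM)
      _ = c * M * (4 * (k * X) + 24 * c * (M + 1) * (k ^ 2 * X)) + 1 / 6 * (M / (M + 1) * F) := by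
        field_simp
        ring
      _ ≤ c * M * (4 * (k ^ 2 * X) + 24 * c * (M + 1) * (k ^ 2 * X)) + 1 / 6 * (1 * F) := by
        gcongr
        rw [div_le_one (by positivity)]
        linarith
      _ = _ := by ring
  nlinarith

theorem energy_bound {M c k X F V W U Z : ℝ} (hM : 0 ≤ M) (hc : 1 ≤ c) (hk : 1 ≤ k)
    (hX : 0 ≤ X) (hF : 0 ≤ F) (hV : 0 ≤ V)
    (hW : ∀ η, 0 < η → W ≤ (4 + 2 / η) * X + 2 * η * F) (hVW : V ≤ M * W)
    (hU : U ≤ c * (k ^ 3 * X + V + k * F)) (hZ : Z ≤ c * (k ^ 3 * X + k * F))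
    (hFU : ∀ τ, 0 < τ → F ≤ 4 / 3 * X + 4 * τ / 3 * U + 1 / (3 * τ) * V) :
    X + U + V + Z + W ≤ (7 + 6 * M + 2 * c + 6 * c * M +
      (2 + 2 * M + 2 * c + 2 * c * M) * (5 + 9 * c * M * (4 + 24 * c * (M + 1)))) *
        (k ^ 3 * X) := by
  have h := energy_elimination hM hc hk hX hF hV hW hVW hU hFU
  set D := 5 + 9 * c * M * (4 + 24 * c * (M + 1)) with hD
  have hk0 : 0 < k := by linarith
  have hc0 : 0 < c := by linarith
  have hD0 : 0 ≤ D := by positivity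
  set Y := k ^ 3 * X with hY
  have hY0 : 0 ≤ Y := by positivity
  have hk2 : k ^ 2 ≤ k ^ 3 := pow_le_pow_right₀ hk (by norm_num)
  have hX1 : X ≤ Y := le_mul_of_one_le_left hX (one_le_pow₀ hk)
  have hkF : k * F ≤ D * Y := by
    calc k * F ≤ k * (D * (k ^ 2 * X)) := by gcongr
      _ = D * Y := by rw [hY]; ring
  have hF1 : F ≤ D * Y := le_trans (le_mul_of_one_le_left hF hk) hkF
  have hW1 : W ≤ (6 + 2 * D) * Y := by
    have := hW 1 one_pos
    norm_num at this
    linarith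
  have hV1 : V ≤ M * ((6 + 2 * D) * Y) := hVW.trans (mul_le_mul_of_nonneg_left hW1 hM)
  have hU1 : U ≤ c * (Y + M * ((6 + 2 * D) * Y) + D * Y) :=
    hU.trans (mul_le_mul_of_nonneg_left (by linarith) hc0.le)
  have hZ1 : Z ≤ c * (Y + D * Y) := hZ.trans (mul_le_mul_of_nonneg_left (by linarith) hc0.le)
  linarith

section
variable {f g : ℝ × ℝ × ℝ → ℝ}

theorem contDiff_fderiv_apply (hf : ContDiff ℝ (⊤ : ℕ∞) f) (e : ℝ × ℝ × ℝ) :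
    ContDiff ℝ (⊤ : ℕ∞) fun q => fderiv ℝ f q e :=
  (hf.fderiv_right (m := (⊤ : ℕ∞)) (by simp)).clm_apply contDiff_const

theorem contDiff_dr (hf : ContDiff ℝ (⊤ : ℕ∞) f) : ContDiff ℝ (⊤ : ℕ∞) (dr f) :=
  contDiff_fderiv_apply hf _

theorem contDiff_dth (hf : ContDiff ℝ (⊤ : ℕ∞) f) : ContDiff ℝ (⊤ : ℕ∞) (dth f) :=
  contDiff_fderiv_apply hf _

theorem contDiff_dz (hf : ContDiff ℝ (⊤ : ℕ∞) f) : ContDiff ℝ (⊤ : ℕ∞) (dz f) :=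
  contDiff_fderiv_apply hf _

theorem fderiv_apply_comm (hf : ContDiff ℝ (⊤ : ℕ∞) f) (e e' q : ℝ × ℝ × ℝ) :
    fderiv ℝ (fun q => fderiv ℝ f q e) q e' = fderiv ℝ (fun q => fderiv ℝ f q e') q e := by
  have hd : DifferentiableAt ℝ (fderiv ℝ f) q :=
    ((hf.fderiv_right (m := (⊤ : ℕ∞)) (by simp)).differentiable (by simp)) q
  have hs : IsSymmSndFDerivAt ℝ f q :=
    hf.contDiffAt.isSymmSndFDerivAt (by
      simp only [minSmoothness_of_isRCLikeNormedField]
      exact WithTop.coe_le_coe.2 le_top)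
  have key : ∀ a b : ℝ × ℝ × ℝ,
      fderiv ℝ (fun q => fderiv ℝ f q a) q b = fderiv ℝ (fderiv ℝ f) q b a := fun a b => by
    rw [fderiv_clm_apply hd (differentiableAt_const a)]
    simp
  rw [key, key]
  exact hs e' e

theorem hasDerivAt_dr (hf : ContDiff ℝ (⊤ : ℕ∞) f) (r θ z : ℝ) :
    HasDerivAt (fun t => f (t, θ, z)) (dr f (r, θ, z)) r :=
  (hf.differentiable (by simp) (r, θ, z)).hasFDerivAt.comp_hasDerivAt r
    ((hasDerivAt_id r).prodMk (hasDerivAt_const r (θ, z)))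

theorem hasDerivAt_dth (hf : ContDiff ℝ (⊤ : ℕ∞) f) (r θ z : ℝ) :
    HasDerivAt (fun t => f (r, t, z)) (dth f (r, θ, z)) θ :=
  (hf.differentiable (by simp) (r, θ, z)).hasFDerivAt.comp_hasDerivAt θ
    ((hasDerivAt_const θ r).prodMk ((hasDerivAt_id θ).prodMk (hasDerivAt_const θ z)))

theorem hasDerivAt_dz (hf : ContDiff ℝ (⊤ : ℕ∞) f) (r θ z : ℝ) :
    HasDerivAt (fun t => f (r, θ, t)) (dz f (r, θ, z)) z :=
  (hf.differentiable (by simp) (r, θ, z)).hasFDerivAt.comp_hasDerivAt z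
    ((hasDerivAt_const z r).prodMk ((hasDerivAt_const z θ).prodMk (hasDerivAt_id z)))

theorem Periodic3.fderiv_apply (hf : Periodic3 f) (e : ℝ × ℝ × ℝ) :
    Periodic3 fun q => fderiv ℝ f q e := fun q => by
  have h : (fun q : ℝ × ℝ × ℝ => f (q + (0, 2 * π, 0))) = f := by
    ext q
    have := hf q
    simpa [Prod.add_def] using this
  have h2 := fderiv_comp_add_right (𝕜 := ℝ) (f := f) (x := q) (0, 2 * π, 0)
  rw [h] at h2
  simp only [h2, Prod.add_def, add_zero]

theorem Periodic3.eq_two_pi (hf : Periodic3 f) (r z : ℝ) : f (r, 2 * π, z) = f (r, 0, z) := by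
  simpa using hf (r, 0, z)

theorem isCompact_shell (h L : ℝ) : IsCompact (shell h L) :=
  isCompact_Icc.prod (isCompact_Icc.prod isCompact_Icc)

theorem measurableSet_shell (h L : ℝ) : MeasurableSet (shell h L) :=
  (isCompact_shell h L).isClosed.measurableSet

theorem shell_integral_eq {h L : ℝ} (hh : 0 ≤ h) (hL : 0 ≤ L) (hf : Continuous f) :
    ∫ q in shell h L, f q =
      ∫ r in (1 - h / 2)..(1 + h / 2), ∫ θ in (0 : ℝ)..(2 * π), ∫ z in (0 : ℝ)..L, f (r, θ, z) := by
  have hp : (0 : ℝ) ≤ 2 * π := by positivity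
  rw [shell, Measure.volume_eq_prod, setIntegral_prod _
    (hf.continuousOn.integrableOn_compact (isCompact_shell h L))]
  simp only [intervalIntegral.integral_of_le hL, intervalIntegral.integral_of_le hp,
    intervalIntegral.integral_of_le (by linarith : 1 - h / 2 ≤ 1 + h / 2),
    ← integral_Icc_eq_integral_Ioc]
  congr 1
  ext r
  rw [Measure.volume_eq_prod, setIntegral_prod _
    (Continuous.continuousOn (by fun_prop) |>.integrableOn_compact
      (isCompact_Icc.prod isCompact_Icc))]

theorem continuous_integral_snd_snd (hf : Continuous f) (a b : ℝ) :
    Continuous fun p : ℝ × ℝ => ∫ z in a..b, f (p.1, p.2, z) :=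
  intervalIntegral.continuous_parametric_intervalIntegral_of_continuous'
    (f := fun (p : ℝ × ℝ) z => f (p.1, p.2, z)) (by unfold Function.uncurry; fun_prop) a b

theorem shell_integral_angle_last {h L : ℝ} (hh : 0 ≤ h) (hL : 0 ≤ L) (hf : Continuous f) :
    ∫ q in shell h L, f q =
      ∫ θ in (0 : ℝ)..(2 * π), rectIntegral h L fun p => f (1 - h / 2 + p.1, θ, p.2) := by
  rw [shell_integral_eq hh hL hf, integral_swap_of_continuous
    (f := fun p : ℝ × ℝ => ∫ z in (0 : ℝ)..L, f (p.1, p.2, z)) (continuous_integral_snd_snd hf 0 L)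
    (by linarith) (by positivity)]
  congr 1
  ext θ
  unfold rectIntegral
  rw [intervalIntegral.integral_comp_add_left (fun r => ∫ z in (0 : ℝ)..L, f (r, θ, z))]
  congr 1 <;> ring

theorem shell_integral_height_last {h L : ℝ} (hh : 0 ≤ h) (hL : 0 ≤ L) (hf : Continuous f) :
    ∫ q in shell h L, f q = ∫ z in (0 : ℝ)..L,
      ∫ r in (1 - h / 2)..(1 + h / 2), ∫ θ in (0 : ℝ)..(2 * π), f (r, θ, z) := by
  rw [shell_integral_eq hh hL hf]
  have : ∀ r, ∫ θ in (0 : ℝ)..(2 * π), ∫ z in (0 : ℝ)..L, f (r, θ, z) =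
      ∫ z in (0 : ℝ)..L, ∫ θ in (0 : ℝ)..(2 * π), f (r, θ, z) := fun r =>
    integral_swap_of_continuous (f := fun p : ℝ × ℝ => f (r, p.1, p.2)) (by fun_prop)
      (by positivity) hL
  simp only [this]
  exact integral_swap_of_continuous
    (f := fun p : ℝ × ℝ => ∫ θ in (0 : ℝ)..(2 * π), f (p.1, θ, p.2))
    (continuous_integral_snd_snd (f := fun q => f (q.1, q.2.2, q.2.1)) (by fun_prop) _ _)
    (by linarith) hL

theorem shell_integral_dz {h L : ℝ} (hh : 0 ≤ h) (hL : 0 ≤ L) (hg : ContDiff ℝ (⊤ : ℕ∞) g)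
    (hb : ∀ r θ, g (r, θ, 0) = g (r, θ, L)) : ∫ q in shell h L, dz g q = 0 := by
  have hc : Continuous (dz g) := (contDiff_dz hg).continuous
  rw [shell_integral_eq hh hL hc]
  have : ∀ r θ, ∫ z in (0 : ℝ)..L, dz g (r, θ, z) = 0 := fun r θ => by
    rw [intervalIntegral.integral_eq_sub_of_hasDerivAt (fun z _ => hasDerivAt_dz hg r θ z)
      (Continuous.intervalIntegrable (by fun_prop) _ _), hb, sub_self]
  simp [this]

theorem shell_integral_dth {h L : ℝ} (hh : 0 ≤ h) (hL : 0 ≤ L) (hg : ContDiff ℝ (⊤ : ℕ∞) g)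
    (hb : Periodic3 g) : ∫ q in shell h L, dth g q = 0 := by
  have hc : Continuous (dth g) := (contDiff_dth hg).continuous
  rw [shell_integral_height_last hh hL hc]
  have : ∀ r z, ∫ θ in (0 : ℝ)..(2 * π), dth g (r, θ, z) = 0 := fun r z => by
    rw [intervalIntegral.integral_eq_sub_of_hasDerivAt (fun θ _ => hasDerivAt_dth hg r θ z)
      (Continuous.intervalIntegrable (by fun_prop) _ _), hb.eq_two_pi, sub_self]
  simp [this]

theorem shell_integral_le_five {h L : ℝ} {f g₁ g₂ g₃ g₄ g₅ : ℝ × ℝ × ℝ → ℝ}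
    (h₁ : Continuous g₁) (h₂ : Continuous g₂) (h₃ : Continuous g₃) (h₄ : Continuous g₄)
    (h₅ : Continuous g₅) (c₁ c₂ c₃ c₄ c₅ : ℝ) (hf : ∀ q, 0 ≤ f q)
    (hle : ∀ q ∈ shell h L, f q ≤ c₁ * g₁ q + c₂ * g₂ q + c₃ * g₃ q + c₄ * g₄ q + c₅ * g₅ q) :
    ∫ q in shell h L, f q ≤ c₁ * (∫ q in shell h L, g₁ q) + c₂ * (∫ q in shell h L, g₂ q) +
      c₃ * (∫ q in shell h L, g₃ q) + c₄ * (∫ q in shell h L, g₄ q) +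
      c₅ * (∫ q in shell h L, g₅ q) := by
  have hi : ∀ {g : ℝ × ℝ × ℝ → ℝ}, Continuous g → Integrable g (volume.restrict (shell h L)) :=
    fun hg => hg.continuousOn.integrableOn_compact (isCompact_shell h L)
  simp only [← integral_const_mul]
  rw [← integral_add (hi (by fun_prop)) (hi (by fun_prop)),
    ← integral_add (hi (by fun_prop)) (hi (by fun_prop)),
    ← integral_add (hi (by fun_prop)) (hi (by fun_prop)),
    ← integral_add (hi (by fun_prop)) (hi (by fun_prop))]
  exact integral_mono_of_nonneg (Filter.Eventually.of_forall hf) (hi (by fun_prop))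
    ((ae_restrict_iff' (measurableSet_shell h L)).2 (Filter.Eventually.of_forall hle))

theorem shell_integral_le_three {h L : ℝ} {f g₁ g₂ g₃ : ℝ × ℝ × ℝ → ℝ}
    (h₁ : Continuous g₁) (h₂ : Continuous g₂) (h₃ : Continuous g₃)
    (c₁ c₂ c₃ : ℝ) (hf : ∀ q, 0 ≤ f q)
    (hle : ∀ q ∈ shell h L, f q ≤ c₁ * g₁ q + c₂ * g₂ q + c₃ * g₃ q) :
    ∫ q in shell h L, f q ≤ c₁ * (∫ q in shell h L, g₁ q) + c₂ * (∫ q in shell h L, g₂ q) +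
      c₃ * (∫ q in shell h L, g₃ q) := by
  have := shell_integral_le_five h₁ h₂ h₃ h₃ h₃ c₁ c₂ c₃ 0 0 hf (by simpa using hle)
  simpa using this

theorem integral_exp_mul_bounds {A B : ℝ} {Φ : ℝ → ℝ} (hA : 1 / 2 ≤ A) (hAB : A ≤ B)
    (hB : B ≤ 3 / 2) (hΦ : Continuous Φ) (h0 : ∀ r, 0 ≤ Φ r) :
    ∫ r in A..B, Φ r ≤ 3 / 2 * ∫ s in (0 : ℝ)..Real.log (B / A), Φ (A * Real.exp s) ∧
      ∫ s in (0 : ℝ)..Real.log (B / A), Φ (A * Real.exp s) ≤ 2 * ∫ r in A..B, Φ r := by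
  have hA0 : 0 < A := by linarith
  have hBA : 0 < B / A := div_pos (by linarith) hA0
  have hH : 0 ≤ Real.log (B / A) := Real.log_nonneg (by rw [le_div_iff₀ hA0]; linarith)
  have hcv := intervalIntegral.integral_comp_mul_deriv (a := 0) (b := Real.log (B / A))
    (f := fun s => A * Real.exp s) (f' := fun s => A * Real.exp s) (g := Φ)
    (fun x _ => (Real.hasDerivAt_exp x).const_mul A) (by fun_prop) hΦ
  rw [Real.exp_zero, mul_one, Real.exp_log hBA, mul_div_cancel₀ _ hA0.ne'] at hcv
  rw [← hcv, ← intervalIntegral.integral_const_mul, ← intervalIntegral.integral_const_mul]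
  have hb : ∀ s ∈ Set.Icc 0 (Real.log (B / A)), A ≤ A * Real.exp s ∧ A * Real.exp s ≤ B :=
    fun s hs => by
      have h1 := Real.one_le_exp hs.1
      have h2 := Real.exp_le_exp.2 hs.2
      rw [Real.exp_log hBA, le_div_iff₀ hA0] at h2
      exact ⟨le_mul_of_one_le_right hA0.le h1, by linarith⟩
  constructor <;>
  · refine intervalIntegral.integral_mono_on hH (Continuous.intervalIntegrable (by fun_prop) _ _)
      (Continuous.intervalIntegrable (by fun_prop) _ _) fun s hs => ?_
    obtain ⟨h1, h2⟩ := hb s hs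
    simp only [Function.comp]
    nlinarith [h0 (A * Real.exp s)]

theorem Periodic3.mul (hf : Periodic3 f) (hg : Periodic3 g) : Periodic3 fun q => f q * g q :=
  fun q => by simp only [hf q, hg q]

theorem fderiv_mul_apply (hf : ContDiff ℝ (⊤ : ℕ∞) f) (hg : ContDiff ℝ (⊤ : ℕ∞) g)
    (q e : ℝ × ℝ × ℝ) :
    fderiv ℝ (fun q => f q * g q) q e = fderiv ℝ f q e * g q + f q * fderiv ℝ g q e := by
  rw [fderiv_fun_mul (hf.differentiable (by simp) q) (hg.differentiable (by simp) q)]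
  simp only [add_apply, smul_apply, smul_eq_mul]
  ring

theorem dz_mul (hf : ContDiff ℝ (⊤ : ℕ∞) f) (hg : ContDiff ℝ (⊤ : ℕ∞) g) (q : ℝ × ℝ × ℝ) :
    dz (fun q => f q * g q) q = dz f q * g q + f q * dz g q :=
  fderiv_mul_apply hf hg q _

theorem dth_mul (hf : ContDiff ℝ (⊤ : ℕ∞) f) (hg : ContDiff ℝ (⊤ : ℕ∞) g) (q : ℝ × ℝ × ℝ) :
    dth (fun q => f q * g q) q = dth f q * g q + f q * dth g q :=
  fderiv_mul_apply hf hg q _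

theorem dz_dth_comm (hf : ContDiff ℝ (⊤ : ℕ∞) f) (q : ℝ × ℝ × ℝ) :
    dz (dth f) q = dth (dz f) q :=
  fderiv_apply_comm hf _ _ q

theorem dz_dr_comm (hf : ContDiff ℝ (⊤ : ℕ∞) f) (q : ℝ × ℝ × ℝ) :
    dz (dr f) q = dr (dz f) q :=
  fderiv_apply_comm hf _ _ q

theorem dth_dr_comm (hf : ContDiff ℝ (⊤ : ℕ∞) f) (q : ℝ × ℝ × ℝ) :
    dth (dr f) q = dr (dth f) q :=
  fderiv_apply_comm hf _ _ q

theorem mem_shell_radius {h L : ℝ} (hh : h < 1) {q : ℝ × ℝ × ℝ} (hq : q ∈ shell h L) :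
    1 / 2 ≤ q.1 ∧ q.1 ≤ 3 / 2 := by
  obtain ⟨⟨h1, h2⟩, -⟩ := hq
  constructor <;> linarith

end

/-- A quadratic form in the displacement gradient comparable to `eSq` on the shell, with all
denominators cleared. -/
def shellEnergy (fr fθ fz : ℝ × ℝ × ℝ → ℝ) (q : ℝ × ℝ × ℝ) : ℝ :=
  dr fr q ^ 2 + (dth fθ q + fr q) ^ 2 + dz fz q ^ 2 +
  (q.1 * dr fθ q + dth fr q - fθ q) ^ 2 + (dz fr q + dr fz q) ^ 2 + (q.1 * dz fθ q + dth fz q) ^ 2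

theorem shellEnergy_nonneg (fr fθ fz : ℝ × ℝ × ℝ → ℝ) (q : ℝ × ℝ × ℝ) :
    0 ≤ shellEnergy fr fθ fz q := by
  unfold shellEnergy
  positivity

theorem shellEnergy_le_eSq {h L : ℝ} (hh : h < 1) (fr fθ fz : ℝ × ℝ × ℝ → ℝ)
    {q : ℝ × ℝ × ℝ} (hq : q ∈ shell h L) :
    shellEnergy fr fθ fz q ≤ 9 / 2 * eSq fr fθ fz q := by
  obtain ⟨h1, h2⟩ := mem_shell_radius hh hq
  have hr : 0 < q.1 := by linarith
  have hr2 : q.1 ^ 2 ≤ 9 / 4 := by nlinarith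
  have key : ∀ x : ℝ, (q.1 * x) ^ 2 ≤ 9 / 4 * x ^ 2 := fun x => by
    rw [mul_pow]
    exact mul_le_mul_of_nonneg_right hr2 (sq_nonneg x)
  have e1 : dth fθ q + fr q = q.1 * ((dth fθ q + fr q) / q.1) := by field_simp
  have e2 : q.1 * dr fθ q + dth fr q - fθ q = q.1 * (dr fθ q + (dth fr q - fθ q) / q.1) := by
    field_simp
    ring
  have e3 : q.1 * dz fθ q + dth fz q = q.1 * (dz fθ q + dth fz q / q.1) := by field_simp
  have k1 := key ((dth fθ q + fr q) / q.1)
  have k2 := key (dr fθ q + (dth fr q - fθ q) / q.1)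
  have k3 := key (dz fθ q + dth fz q / q.1)
  rw [← e1] at k1
  rw [← e2] at k2
  rw [← e3] at k3
  unfold shellEnergy eSq
  nlinarith [sq_nonneg (dr fr q), sq_nonneg (dz fz q), sq_nonneg (dz fr q + dr fz q),
    sq_nonneg ((dth fθ q + fr q) / q.1)]

theorem gradSq_nonneg (fr fθ fz : ℝ × ℝ × ℝ → ℝ) (q : ℝ × ℝ × ℝ) :
    0 ≤ gradSq fr fθ fz q := by
  unfold gradSq
  positivity

theorem gradSq_le {h L : ℝ} (hh : h < 1) (fr fθ fz : ℝ × ℝ × ℝ → ℝ)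
    {q : ℝ × ℝ × ℝ} (hq : q ∈ shell h L) :
    gradSq fr fθ fz q ≤ 100 * shellEnergy fr fθ fz q + 100 * dth fr q ^ 2 +
      100 * fθ q ^ 2 + 100 * dz fr q ^ 2 + 100 * dz fθ q ^ 2 := by
  obtain ⟨h1, h2⟩ := mem_shell_radius hh hq
  have hr : 0 < q.1 := by linarith
  have hdiv : ∀ x : ℝ, (x / q.1) ^ 2 ≤ 4 * x ^ 2 := fun x => by
    have : (1 : ℝ) ≤ 4 * q.1 ^ 2 := by nlinarith
    rw [div_pow, div_le_iff₀ (by positivity)]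
    nlinarith [sq_nonneg x]
  have hmul : dr fθ q ^ 2 ≤ 4 * (q.1 * dr fθ q) ^ 2 := by
    have : (1 : ℝ) ≤ 4 * q.1 ^ 2 := by nlinarith
    nlinarith [sq_nonneg (dr fθ q)]
  have hp : (q.1 * dz fθ q) ^ 2 ≤ 9 / 4 * dz fθ q ^ 2 := by
    have : q.1 ^ 2 ≤ 9 / 4 := by nlinarith
    nlinarith [sq_nonneg (dz fθ q)]
  have k1 := hdiv (dth fr q - fθ q)
  have k2 := hdiv (dth fθ q + fr q)
  have k3 := hdiv (dth fz q)
  unfold gradSq shellEnergy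
  set x := q.1 * dr fθ q
  set y := q.1 * dz fθ q
  have s1 : x ^ 2 ≤ 3 * (x + dth fr q - fθ q) ^ 2 + 3 * dth fr q ^ 2 + 3 * fθ q ^ 2 := by
    nlinarith [sq_nonneg (x + dth fr q - fθ q + dth fr q), sq_nonneg (dth fr q + fθ q),
      sq_nonneg (x + dth fr q - fθ q - fθ q)]
  have s2 : dr fz q ^ 2 ≤ 2 * (dz fr q + dr fz q) ^ 2 + 2 * dz fr q ^ 2 := by
    nlinarith [sq_nonneg (dz fr q + dr fz q + dz fr q)]
  have s3 : dth fz q ^ 2 ≤ 2 * (y + dth fz q) ^ 2 + 2 * y ^ 2 := by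
    nlinarith [sq_nonneg (y + dth fz q + y)]
  have s4 : (dth fr q - fθ q) ^ 2 ≤ 2 * dth fr q ^ 2 + 2 * fθ q ^ 2 := by
    nlinarith [sq_nonneg (dth fr q + fθ q)]
  nlinarith [sq_nonneg (dr fr q), sq_nonneg (dz fz q), sq_nonneg (dth fθ q + fr q),
    sq_nonneg (dz fr q), sq_nonneg (dz fθ q), sq_nonneg (dth fr q), sq_nonneg (fθ q),
    sq_nonneg (x + dth fr q - fθ q), sq_nonneg (dz fr q + dr fz q), sq_nonneg (y + dth fz q)]

section
variable {h L : ℝ} {fr fθ fz : ℝ × ℝ × ℝ → ℝ}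

theorem continuous_shellEnergy (hr : ContDiff ℝ (⊤ : ℕ∞) fr) (hθ : ContDiff ℝ (⊤ : ℕ∞) fθ)
    (hz : ContDiff ℝ (⊤ : ℕ∞) fz) : Continuous (shellEnergy fr fθ fz) := by
  have c1 := hr.continuous
  have c2 := hθ.continuous
  have c3 := (contDiff_dr hr).continuous
  have c4 := (contDiff_dth hr).continuous
  have c5 := (contDiff_dz hr).continuous
  have c6 := (contDiff_dr hθ).continuous
  have c7 := (contDiff_dth hθ).continuous
  have c8 := (contDiff_dz hθ).continuous
  have c9 := (contDiff_dr hz).continuous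
  have c10 := (contDiff_dth hz).continuous
  have c11 := (contDiff_dz hz).continuous
  unfold shellEnergy
  fun_prop

theorem shell_integral_shellEnergy_le (hh : h < 1) (hr : ContDiff ℝ (⊤ : ℕ∞) fr)
    (hθ : ContDiff ℝ (⊤ : ℕ∞) fθ) (hz : ContDiff ℝ (⊤ : ℕ∞) fz) :
    ∫ q in shell h L, shellEnergy fr fθ fz q ≤ 9 / 2 * ∫ q in shell h L, eSq fr fθ fz q := by
  have c1 := hr.continuous
  have c2 := hθ.continuous
  have c3 := (contDiff_dr hr).continuous
  have c4 := (contDiff_dth hr).continuous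
  have c5 := (contDiff_dz hr).continuous
  have c6 := (contDiff_dr hθ).continuous
  have c7 := (contDiff_dth hθ).continuous
  have c8 := (contDiff_dz hθ).continuous
  have c9 := (contDiff_dr hz).continuous
  have c10 := (contDiff_dth hz).continuous
  have c11 := (contDiff_dz hz).continuous
  have hi : ContinuousOn (eSq fr fθ fz) (shell h L) := by
    have h0 : ∀ q ∈ shell h L, q.1 ≠ 0 := fun q hq =>
      (lt_of_lt_of_le (by norm_num) (mem_shell_radius hh hq).1).ne'
    have hdiv : ∀ {f : ℝ × ℝ × ℝ → ℝ}, Continuous f →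
        ContinuousOn (fun q => f q / q.1) (shell h L) :=
      fun hf => hf.continuousOn.div continuousOn_fst h0
    have d1 := hdiv (c7.add c1)
    have d2 := hdiv (c4.sub c2)
    have d3 := hdiv c10
    unfold eSq
    simp only [Pi.add_apply, Pi.sub_apply] at d1 d2
    fun_prop
  rw [← integral_const_mul]
  exact integral_mono_of_nonneg (Filter.Eventually.of_forall (shellEnergy_nonneg fr fθ fz))
    ((hi.integrableOn_compact (isCompact_shell h L)).const_mul _)
    ((ae_restrict_iff' (measurableSet_shell h L)).2
      (Filter.Eventually.of_forall fun q hq => shellEnergy_le_eSq hh fr fθ fz hq))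

theorem shell_integral_dz_angular_le (h0 : 0 ≤ h) (hh : h < 1) (hL : 0 ≤ L)
    (hr : ContDiff ℝ (⊤ : ℕ∞) fr) (hθ : ContDiff ℝ (⊤ : ℕ∞) fθ) (hz : ContDiff ℝ (⊤ : ℕ∞) fz)
    (pθ : Periodic3 fθ) (pz : Periodic3 fz) (hb : BC1 L fr fθ fz) {η : ℝ} (hη : 0 < η) :
    ∫ q in shell h L, dz fθ q ^ 2 ≤ (4 + 2 / η) * (∫ q in shell h L, shellEnergy fr fθ fz q) +
      2 * η * ∫ q in shell h L, fr q ^ 2 := by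
  have s1 : ContDiff ℝ (⊤ : ℕ∞) fun q => fθ q * dth fz q := hθ.mul (contDiff_dth hz)
  have s2 : ContDiff ℝ (⊤ : ℕ∞) fun q => fθ q * dz fz q := hθ.mul (contDiff_dz hz)
  have i1 := shell_integral_dz h0 hL s1 fun r θ => by
    simp only [(hb r θ).2.1, (hb r θ).2.2.2.2, zero_mul]
  have i2 := shell_integral_dth h0 hL s2 (pθ.mul (pz.fderiv_apply _))
  have key := shell_integral_le_five (h := h) (L := L) (f := fun q => dz fθ q ^ 2)
    (continuous_shellEnergy hr hθ hz) (hr.continuous.pow 2) (contDiff_dz s1).continuous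
    (contDiff_dth s2).continuous continuous_const (g₅ := fun _ => 0) (4 + 2 / η) (2 * η) (-4) 4 0
    (fun q => sq_nonneg _) fun q hq => by
      rw [dz_mul hθ (contDiff_dth hz), dth_mul hθ (contDiff_dz hz), dz_dth_comm hz]
      obtain ⟨h1, -⟩ := mem_shell_radius hh hq
      have e1 : 4 * (fr q * dz fz q) ≤ 2 * η * fr q ^ 2 + 2 / η * dz fz q ^ 2 := by
        have := weighted_mul_le hη (fr q) (dz fz q)
        have e : dz fz q ^ 2 / (2 * η) = 1 / 4 * (2 / η * dz fz q ^ 2) := by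
          field_simp
          ring
        linarith
      have e2 : 2 / η * dz fz q ^ 2 ≤ 2 / η * shellEnergy fr fθ fz q := by
        gcongr
        unfold shellEnergy
        nlinarith [sq_nonneg (dr fr q), sq_nonneg (dth fθ q + fr q),
          sq_nonneg (q.1 * dr fθ q + dth fr q - fθ q), sq_nonneg (dz fr q + dr fz q),
          sq_nonneg (q.1 * dz fθ q + dth fz q)]
      have e3 : q.1 * dz fθ q ^ 2 ≥ 1 / 2 * dz fθ q ^ 2 := by gcongr
      have e4 : 4 * (q.1 * dz fθ q + dth fz q) ^ 2 + 2 * ((dth fθ q + fr q) ^ 2 + dz fz q ^ 2) ≤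
          4 * shellEnergy fr fθ fz q := by
        unfold shellEnergy
        nlinarith [sq_nonneg (dr fr q), sq_nonneg (dth fθ q + fr q), sq_nonneg (dz fz q),
          sq_nonneg (q.1 * dr fθ q + dth fr q - fθ q), sq_nonneg (dz fr q + dr fz q)]
      simp only [Pi.pow_apply]
      nlinarith [sq_nonneg (dz fθ q - 2 * (q.1 * dz fθ q + dth fz q)),
        sq_nonneg (dth fθ q + fr q + dz fz q)]
  rw [i1, i2] at key
  simpa using key

theorem shell_integral_angular_le (h0 : 0 ≤ h) (hL : 0 ≤ L)
    (hθ : ContDiff ℝ (⊤ : ℕ∞) fθ) (hb : BC1 L fr fθ fz) :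
    ∫ q in shell h L, fθ q ^ 2 ≤ 4 * L ^ 2 * ∫ q in shell h L, dz fθ q ^ 2 := by
  have sl : ContDiff ℝ (⊤ : ℕ∞) fun q : ℝ × ℝ × ℝ => q.2.2 - L := by fun_prop
  have s1 : ContDiff ℝ (⊤ : ℕ∞) fun q : ℝ × ℝ × ℝ => (q.2.2 - L) * (fθ q * fθ q) :=
    sl.mul (hθ.mul hθ)
  have i1 := shell_integral_dz h0 hL s1 fun r θ => by
    simp only [(hb r θ).2.1, (hb r θ).2.2.2.2, mul_zero]
  have dl : ∀ q : ℝ × ℝ × ℝ, dz (fun q => q.2.2 - L) q = 1 := fun q => by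
    obtain ⟨r, θ, z⟩ := q
    exact (hasDerivAt_dz sl r θ z).unique ((hasDerivAt_id z).sub_const L)
  have key := shell_integral_le_three (h := h) (L := L) (f := fun q => fθ q ^ 2)
    ((contDiff_dz hθ).continuous.pow 2) (contDiff_dz s1).continuous
    continuous_const (g₃ := fun _ => 0) (4 * L ^ 2) 2 0
    (fun q => sq_nonneg _) fun q hq => by
      rw [dz_mul sl (hθ.mul hθ), dz_mul hθ hθ, dl]
      obtain ⟨-, -, h1, h2⟩ := hq
      have e1 : ((q.2.2 - L) * dz fθ q) ^ 2 ≤ L ^ 2 * dz fθ q ^ 2 := by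
        rw [mul_pow]
        gcongr ?_ * _
        nlinarith
      simp only [Pi.pow_apply]
      nlinarith [sq_nonneg (fθ q + 2 * ((q.2.2 - L) * dz fθ q))]
  rw [i1] at key
  simpa using key

theorem shell_integral_radial_le (h0 : 0 ≤ h) (hL : 0 ≤ L)
    (hr : ContDiff ℝ (⊤ : ℕ∞) fr) (hθ : ContDiff ℝ (⊤ : ℕ∞) fθ) (hz : ContDiff ℝ (⊤ : ℕ∞) fz)
    (pr : Periodic3 fr) (pθ : Periodic3 fθ) {τ : ℝ} (hτ : 0 < τ) :
    ∫ q in shell h L, fr q ^ 2 ≤ 4 / 3 * (∫ q in shell h L, shellEnergy fr fθ fz q) +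
      4 * τ / 3 * (∫ q in shell h L, dth fr q ^ 2) +
      1 / (3 * τ) * ∫ q in shell h L, fθ q ^ 2 := by
  have s1 : ContDiff ℝ (⊤ : ℕ∞) fun q => fr q * fθ q := hr.mul hθ
  have i1 := shell_integral_dth h0 hL s1 (pr.mul pθ)
  have key := shell_integral_le_five (h := h) (L := L) (f := fun q => fr q ^ 2)
    (continuous_shellEnergy hr hθ hz) ((contDiff_dth hr).continuous.pow 2)
    (hθ.continuous.pow 2) (contDiff_dth s1).continuous
    continuous_const (g₅ := fun _ => 0) (4 / 3) (4 * τ / 3) (1 / (3 * τ)) (-(4 / 3)) 0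
    (fun q => sq_nonneg _) fun q hq => by
      rw [dth_mul hr hθ]
      have e1 : 4 / 3 * (dth fr q * fθ q) ≤ 4 * τ / 3 * dth fr q ^ 2 + 1 / (3 * τ) * fθ q ^ 2 := by
        have := weighted_mul_le (by positivity : 0 < 2 * τ) (dth fr q) (fθ q)
        have e : fθ q ^ 2 / (2 * (2 * τ)) = 3 / 4 * (1 / (3 * τ) * fθ q ^ 2) := by
          field_simp
          ring
        linarith
      have e2 : (dth fθ q + fr q) ^ 2 ≤ shellEnergy fr fθ fz q := by
        unfold shellEnergy
        nlinarith [sq_nonneg (dr fr q), sq_nonneg (dz fz q),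
          sq_nonneg (q.1 * dr fθ q + dth fr q - fθ q), sq_nonneg (dz fr q + dr fz q),
          sq_nonneg (q.1 * dz fθ q + dth fz q)]
      simp only [Pi.pow_apply]
      nlinarith [sq_nonneg (fr q - 2 * (dth fθ q + fr q))]
  rw [i1] at key
  simpa using key

theorem continuous_rectIntegral {H T : ℝ} {F : ℝ → ℝ × ℝ → ℝ}
    (hF : Continuous fun x : ℝ × ℝ × ℝ => F x.1 x.2) :
    Continuous fun t => rectIntegral H T (F t) := by
  unfold rectIntegral
  refine intervalIntegral.continuous_parametric_intervalIntegral_of_continuous'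
    (f := fun t x => ∫ y in (0 : ℝ)..T, F t (x, y)) ?_ 0 H
  exact intervalIntegral.continuous_parametric_intervalIntegral_of_continuous'
    (f := fun (p : ℝ × ℝ) y => F p.1 (p.2, y))
    (hF.comp (by fun_prop : Continuous fun x : (ℝ × ℝ) × ℝ => (x.1.1, (x.1.2, x.2)))) 0 T

theorem shell_integral_dz_radial_le (h0 : 0 < h) (hh : h < 1) (hL : 0 ≤ L)
    (hr : ContDiff ℝ (⊤ : ℕ∞) fr) (hθ : ContDiff ℝ (⊤ : ℕ∞) fθ) (hz : ContDiff ℝ (⊤ : ℕ∞) fz)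
    (hb : BC1 L fr fθ fz) {δ : ℝ} (hδ : 0 < δ) :
    ∫ q in shell h L, dz fr q ^ 2 ≤
      100000 * ((1 + 1 / (δ * h)) * (∫ q in shell h L, shellEnergy fr fθ fz q) +
        δ / h * ∫ q in shell h L, fr q ^ 2) := by
  have c1 := hr.continuous
  have c2 := (contDiff_dr hr).continuous
  have c3 := (contDiff_dz hr).continuous
  have c4 := (contDiff_dr hz).continuous
  have c5 := (contDiff_dz hz).continuous
  have c6 := (contDiff_dz (contDiff_dr hz)).continuous
  set G : ℝ × ℝ × ℝ → ℝ := fun q => (dr fz q + dz fr q) ^ 2 +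
    (1 + 1 / (δ * h)) * ((dz fz q + 0 * fr q) ^ 2 + dr fr q ^ 2) + δ / h * fr q ^ 2 with hG
  have cG : Continuous G := by fun_prop
  have sG : ∀ q, 0 ≤ G q := fun q => by positivity
  have strip : ∀ θ, StripField L (fun p => fr (1 - h / 2 + p.1, θ, p.2))
      (fun p => dr fr (1 - h / 2 + p.1, θ, p.2)) (fun p => dz fr (1 - h / 2 + p.1, θ, p.2))
      (fun p => dr fz (1 - h / 2 + p.1, θ, p.2)) (fun p => dz fz (1 - h / 2 + p.1, θ, p.2))
      (fun p => dz (dr fz) (1 - h / 2 + p.1, θ, p.2)) := fun θ =>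
    { cont_u := by fun_prop
      cont_ux := by fun_prop
      cont_uy := by fun_prop
      cont_vx := by fun_prop
      cont_vy := by fun_prop
      cont_vxy := by fun_prop
      deriv_ux := fun x y => (hasDerivAt_dr hr (1 - h / 2 + x) θ y).comp_const_add (1 - h / 2) x
      deriv_uy := fun x y => hasDerivAt_dz hr (1 - h / 2 + x) θ y
      deriv_vxy := fun x y => hasDerivAt_dz (contDiff_dr hz) (1 - h / 2 + x) θ y
      deriv_vyx := fun x y => by
        rw [dz_dr_comm hz]
        exact (hasDerivAt_dr (contDiff_dz hz) (1 - h / 2 + x) θ y).comp_const_add (1 - h / 2) x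
      boundary := fun x x' => by simp only [(hb _ θ).1, (hb _ θ).2.2.2.1, zero_mul] }
  have key : ∫ q in shell h L, dz fr q ^ 2 ≤ 100000 * ∫ q in shell h L, G q := by
    rw [shell_integral_angle_last h0.le hL (by fun_prop), shell_integral_angle_last h0.le hL cG,
      ← intervalIntegral.integral_const_mul]
    refine intervalIntegral.integral_mono_on (by positivity)
      (Continuous.intervalIntegrable (continuous_rectIntegral (by fun_prop)) _ _)
      (Continuous.intervalIntegrable
        (continuous_const.mul (continuous_rectIntegral (by fun_prop))) _ _) fun θ _ => ?_
    exact (strip θ).korn hL h0 (by linarith) hδ (κ := 0) (by simp)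
  refine key.trans (mul_le_mul_of_nonneg_left ?_ (by norm_num))
  have := shell_integral_le_three (h := h) (L := L) (f := G) (continuous_shellEnergy hr hθ hz)
    (hr.continuous.pow 2) continuous_const (g₃ := fun _ => 0) (1 + 1 / (δ * h)) (δ / h) 0 sG
    fun q _ => by
      have hE : (dr fz q + dz fr q) ^ 2 + (dz fz q ^ 2 + dr fr q ^ 2) ≤
          shellEnergy fr fθ fz q := by
        unfold shellEnergy
        nlinarith [sq_nonneg (dth fθ q + fr q),
          sq_nonneg (q.1 * dr fθ q + dth fr q - fθ q), sq_nonneg (q.1 * dz fθ q + dth fz q)]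
      have hk : 0 ≤ 1 / (δ * h) := by positivity
      have := mul_le_mul_of_nonneg_left hE (by positivity : 0 ≤ 1 + 1 / (δ * h))
      have := mul_nonneg hk (sq_nonneg (dr fz q + dz fr q))
      simp only [hG, Pi.pow_apply, zero_mul, add_zero, mul_zero]
      nlinarith
  simpa using this

theorem log_ratio_bounds (h0 : 0 < h) (hh : h < 1) :
    2 / 3 * h ≤ Real.log ((1 + h / 2) / (1 - h / 2)) ∧
      Real.log ((1 + h / 2) / (1 - h / 2)) ≤ 2 * h := by
  have hA : 0 < 1 - h / 2 := by linarith
  have hBA : 0 < (1 + h / 2) / (1 - h / 2) := by positivity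
  constructor
  · refine le_trans ?_ (Real.one_sub_inv_le_log_of_pos hBA)
    rw [inv_div, one_sub_div (by positivity), le_div_iff₀ (by positivity)]
    nlinarith
  · refine (Real.log_le_sub_one_of_pos hBA).trans ?_
    rw [div_sub_one hA.ne', div_le_iff₀ hA]
    nlinarith

theorem angular_strip_energy_le {H δ : ℝ} (h0 : 0 < h) (hh : h < 1) (hδ : 0 < δ)
    (hH : 2 / 3 * h ≤ H) {q : ℝ × ℝ × ℝ} (hq : q ∈ shell h L) :
    (q.1 * dr fθ q + dth fr q) ^ 2 + (1 + 1 / (δ * H)) *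
        ((dth fθ q + 1 * fr q) ^ 2 + (q.1 * dr fr q) ^ 2) + δ / H * fr q ^ 2 ≤
      (5 + 4 / (δ * h)) * shellEnergy fr fθ fz q + 2 * fθ q ^ 2 + 2 * (δ / h) * fr q ^ 2 := by
  obtain ⟨h1, h2⟩ := mem_shell_radius hh hq
  have hH0 : 0 < H := by linarith
  have k1 : 1 / (δ * H) ≤ 3 / 2 * (1 / (δ * h)) := by
    rw [show 3 / 2 * (1 / (δ * h)) = 1 / (δ * (2 / 3 * h)) by field_simp]
    gcongr
  have k2 : δ / H ≤ 2 * (δ / h) := by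
    rw [show 2 * (δ / h) = δ / (1 / 2 * h) by field_simp]
    gcongr
    linarith
  have k3 : 0 < 1 / (δ * h) := by positivity
  have e4 : 4 / (δ * h) = 4 * (1 / (δ * h)) := by ring
  rw [e4]
  set k := 1 / (δ * h)
  have e1 : (q.1 * dr fθ q + dth fr q) ^ 2 ≤
      2 * (q.1 * dr fθ q + dth fr q - fθ q) ^ 2 + 2 * fθ q ^ 2 := by
    nlinarith [sq_nonneg (q.1 * dr fθ q + dth fr q - fθ q - fθ q)]
  have e2 : (q.1 * dr fr q) ^ 2 ≤ 9 / 4 * dr fr q ^ 2 := by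
    have : q.1 ^ 2 ≤ 9 / 4 := by nlinarith
    nlinarith [sq_nonneg (dr fr q)]
  have e3 : δ / H * fr q ^ 2 ≤ 2 * (δ / h) * fr q ^ 2 := by gcongr
  have e5 : (1 + 1 / (δ * H)) * ((dth fθ q + 1 * fr q) ^ 2 + (q.1 * dr fr q) ^ 2) ≤
      (1 + 3 / 2 * k) * (9 / 4 * ((dth fθ q + fr q) ^ 2 + dr fr q ^ 2)) := by
    rw [one_mul]
    gcongr
    nlinarith [sq_nonneg (dth fθ q + fr q)]
  have e6 : (q.1 * dr fθ q + dth fr q - fθ q) ^ 2 + ((dth fθ q + fr q) ^ 2 + dr fr q ^ 2) ≤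
      shellEnergy fr fθ fz q := by
    unfold shellEnergy
    nlinarith [sq_nonneg (dz fz q), sq_nonneg (dz fr q + dr fz q),
      sq_nonneg (q.1 * dz fθ q + dth fz q)]
  have e7 := mul_le_mul_of_nonneg_left e6 (by positivity : 0 ≤ 5 + 4 * k)
  have e8 := mul_nonneg k3.le (sq_nonneg (q.1 * dr fθ q + dth fr q - fθ q))
  have e9 := mul_nonneg k3.le (sq_nonneg (dth fθ q + fr q))
  have e10 := mul_nonneg k3.le (sq_nonneg (dr fr q))
  nlinarith [sq_nonneg (q.1 * dr fθ q + dth fr q - fθ q), sq_nonneg (dth fθ q + fr q),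
    sq_nonneg (dr fr q)]

theorem shell_integral_dth_radial_le (h0 : 0 < h) (hh : h < 1) (hL : 0 ≤ L)
    (hr : ContDiff ℝ (⊤ : ℕ∞) fr) (hθ : ContDiff ℝ (⊤ : ℕ∞) fθ) (hz : ContDiff ℝ (⊤ : ℕ∞) fz)
    (pr : Periodic3 fr) (pθ : Periodic3 fθ) {δ : ℝ} (hδ : 0 < δ) :
    ∫ q in shell h L, dth fr q ^ 2 ≤
      300000 * ((5 + 4 / (δ * h)) * (∫ q in shell h L, shellEnergy fr fθ fz q) +
        2 * (∫ q in shell h L, fθ q ^ 2) + 2 * (δ / h) * ∫ q in shell h L, fr q ^ 2) := by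
  have c1 := hr.continuous
  have c2 := (contDiff_dr hr).continuous
  have c3 := (contDiff_dth hr).continuous
  have c4 := (contDiff_dr hθ).continuous
  have c5 := (contDiff_dth hθ).continuous
  have c6 := (contDiff_dth (contDiff_dr hθ)).continuous
  obtain ⟨hH1, hH2⟩ := log_ratio_bounds h0 hh
  set H := Real.log ((1 + h / 2) / (1 - h / 2)) with hH
  have hH0 : 0 < H := by linarith
  set G : ℝ × ℝ × ℝ → ℝ := fun q => (q.1 * dr fθ q + dth fr q) ^ 2 + (1 + 1 / (δ * H)) *
    ((dth fθ q + 1 * fr q) ^ 2 + (q.1 * dr fr q) ^ 2) + δ / H * fr q ^ 2 with hG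
  have cG : Continuous G := by fun_prop
  have sG : ∀ q, 0 ≤ G q := fun q => by positivity
  set A := 1 - h / 2 with hA
  have dexp : ∀ x : ℝ, HasDerivAt (fun s => A * Real.exp s) (A * Real.exp x) x := fun x =>
    (Real.hasDerivAt_exp x).const_mul A
  have strip : ∀ z, StripField (2 * π) (fun p => fr (A * Real.exp p.1, p.2, z))
      (fun p => A * Real.exp p.1 * dr fr (A * Real.exp p.1, p.2, z))
      (fun p => dth fr (A * Real.exp p.1, p.2, z))
      (fun p => A * Real.exp p.1 * dr fθ (A * Real.exp p.1, p.2, z))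
      (fun p => dth fθ (A * Real.exp p.1, p.2, z))
      (fun p => A * Real.exp p.1 * dth (dr fθ) (A * Real.exp p.1, p.2, z)) := fun z =>
    { cont_u := by fun_prop
      cont_ux := by fun_prop
      cont_uy := by fun_prop
      cont_vx := by fun_prop
      cont_vy := by fun_prop
      cont_vxy := by fun_prop
      deriv_ux := fun x y => by
        rw [mul_comm]
        exact (hasDerivAt_dr hr _ y z).comp x (dexp x)
      deriv_uy := fun x y => hasDerivAt_dth hr (A * Real.exp x) y z
      deriv_vxy := fun x y => (hasDerivAt_dth (contDiff_dr hθ) (A * Real.exp x) y z).const_mul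
        (A * Real.exp x)
      deriv_vyx := fun x y => by
        rw [mul_comm, dth_dr_comm hθ]
        exact (hasDerivAt_dr (contDiff_dth hθ) _ y z).comp x (dexp x)
      boundary := fun x x' => by
        simp only [pr.eq_two_pi, (pθ.fderiv_apply (1, 0, 0)).eq_two_pi, dr] }
  have key : ∫ q in shell h L, dth fr q ^ 2 ≤ 300000 * ∫ q in shell h L, G q := by
    have cint : ∀ {f : ℝ × ℝ × ℝ → ℝ}, Continuous f →
        Continuous fun p : ℝ × ℝ => ∫ θ in (0 : ℝ)..(2 * π), f (p.2, θ, p.1) := fun {f} hf =>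
      continuous_integral_snd_snd (f := fun q => f (q.2.1, q.2.2, q.1)) (by fun_prop) _ _
    have cint2 : ∀ {f : ℝ × ℝ × ℝ → ℝ}, Continuous f →
        Continuous fun z => ∫ r in A..(1 + h / 2), ∫ θ in (0 : ℝ)..(2 * π), f (r, θ, z) :=
      fun hf => continuous_inner_integral (cint hf) _ _
    have bounds : ∀ {f : ℝ × ℝ × ℝ → ℝ}, Continuous f → (∀ q, 0 ≤ f q) → ∀ z, _ :=
      fun {f} hf hf0 z => integral_exp_mul_bounds (A := A) (B := 1 + h / 2)
        (Φ := fun r => ∫ θ in (0 : ℝ)..(2 * π), f (r, θ, z)) (by linarith) (by linarith)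
        (by linarith) ((cint hf).comp (by fun_prop : Continuous fun r => (z, r)))
        fun r => intervalIntegral.integral_nonneg (by positivity) fun θ _ => hf0 _
    rw [shell_integral_height_last h0.le hL (by fun_prop), shell_integral_height_last h0.le hL cG,
      ← intervalIntegral.integral_const_mul]
    refine intervalIntegral.integral_mono_on hL
      (Continuous.intervalIntegrable (cint2 (c3.pow 2)) _ _)
      (Continuous.intervalIntegrable (continuous_const.mul (cint2 cG)) _ _) fun z _ => ?_
    have b1 := (bounds (c3.pow 2) (fun q => sq_nonneg _) z).1
    have b2 := (bounds cG sG z).2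
    have b3 := (strip z).korn (by positivity) hH0 (by linarith) hδ (κ := 1) (by simp)
    simp only [rectIntegral, stripEnergy] at b3
    simp only [hG, Pi.pow_apply] at b1 b2 ⊢
    linarith
  refine key.trans (mul_le_mul_of_nonneg_left ?_ (by norm_num))
  exact shell_integral_le_three (continuous_shellEnergy hr hθ hz) (hθ.continuous.pow 2)
    (hr.continuous.pow 2) _ _ _ sG fun q hq => angular_strip_energy_le h0 hh hδ hH1 hq

end

/-- Ansatz-free lower bound (Theorem 2.2): K(V_h¹) ≥ C(L) h^{3/2}, i.e.
‖∇φ‖² ≤ C(L)⁻¹ h^{−3/2} ‖e(φ)‖² for all φ ∈ V_h¹. -/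
theorem korn_constant_lower_bound :
    ∀ L : ℝ, 0 < L → ∃ C : ℝ, 0 < C ∧ ∀ h : ℝ, 0 < h → h < 1 →
      ∀ fr fθ fz : ℝ × ℝ × ℝ → ℝ,
        ContDiff ℝ (⊤ : ℕ∞) fr → ContDiff ℝ (⊤ : ℕ∞) fθ → ContDiff ℝ (⊤ : ℕ∞) fz →
        Periodic3 fr → Periodic3 fθ → Periodic3 fz →
        BC1 L fr fθ fz →
        C * h ^ ((3:ℝ)/2) * (∫ q in shell h L, gradSq fr fθ fz q)
          ≤ ∫ q in shell h L, eSq fr fθ fz q := by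

  intro L hL
  set D : ℝ := 7 + 6 * (4 * L ^ 2) + 2 * 3000000 + 6 * 3000000 * (4 * L ^ 2) +
    (2 + 2 * (4 * L ^ 2) + 2 * 3000000 + 2 * 3000000 * (4 * L ^ 2)) *
      (5 + 9 * 3000000 * (4 * L ^ 2) * (4 + 24 * 3000000 * (4 * L ^ 2 + 1))) with hD
  have hD0 : 0 < D := by positivity
  refine ⟨1 / (450 * D), by positivity, fun h h0 hh fr fθ fz hr hθ hz pr pθ pz hb => ?_⟩
  obtain ⟨s, hs0, rfl⟩ : ∃ s, 0 < s ∧ h = s ^ 2 :=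
    ⟨Real.sqrt h, Real.sqrt_pos.2 h0, (Real.sq_sqrt h0.le).symm⟩
  have hs1 : s < 1 := by nlinarith
  have hpow : (s ^ 2) ^ ((3 : ℝ) / 2) = s ^ 3 := by
    rw [← Real.rpow_natCast, ← Real.rpow_natCast, ← Real.rpow_mul hs0.le]
    norm_num
  have hk : 1 ≤ 1 / s := by rw [le_div_iff₀ hs0]; linarith
  have hX := setIntegral_nonneg (μ := volume) (measurableSet_shell (s ^ 2) L)
    fun q _ => shellEnergy_nonneg fr fθ fz q
  have hF := setIntegral_nonneg (μ := volume) (measurableSet_shell (s ^ 2) L)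
    fun q _ => sq_nonneg (fr q)
  have hV := setIntegral_nonneg (μ := volume) (measurableSet_shell (s ^ 2) L)
    fun q _ => sq_nonneg (fθ q)
  have hU := shell_integral_dth_radial_le h0 hh hL.le hr hθ hz pr pθ hs0
  have hZ := shell_integral_dz_radial_le h0 hh hL.le hr hθ hz hb hs0
  have hG := shell_integral_le_five (h := s ^ 2) (L := L) (f := gradSq fr fθ fz)
    (continuous_shellEnergy hr hθ hz)
    ((contDiff_dth hr).continuous.pow 2) (hθ.continuous.pow 2)
    ((contDiff_dz hr).continuous.pow 2) ((contDiff_dz hθ).continuous.pow 2)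
    100 100 100 100 100 (gradSq_nonneg fr fθ fz) fun q hq => gradSq_le hh fr fθ fz hq
  have hE := shell_integral_shellEnergy_le (L := L) hh hr hθ hz
  simp only [Pi.pow_apply] at hG
  rw [show 1 / (s * s ^ 2) = (1 / s) ^ 3 by field_simp, show s / s ^ 2 = 1 / s by field_simp] at hZ
  rw [show 4 / (s * s ^ 2) = 4 * (1 / s) ^ 3 by field_simp,
    show s / s ^ 2 = 1 / s by field_simp] at hU
  set X := ∫ q in shell (s ^ 2) L, shellEnergy fr fθ fz q
  set F := ∫ q in shell (s ^ 2) L, fr q ^ 2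
  have hX3 : X ≤ (1 / s) ^ 3 * X := le_mul_of_one_le_left hX (one_le_pow₀ hk)
  have hkF : 0 ≤ 1 / s * F := by positivity
  have main := energy_bound (Z := ∫ q in shell (s ^ 2) L, dz fr q ^ 2)
    (by positivity : 0 ≤ 4 * L ^ 2) (by norm_num : (1 : ℝ) ≤ 3000000)
    hk hX hF hV
    (fun η hη => shell_integral_dz_angular_le h0.le hh hL.le hr hθ hz pθ pz hb hη)
    (shell_integral_angular_le h0.le hL.le hθ hb)
    (by nlinarith) (by nlinarith)
    (fun τ hτ => shell_integral_radial_le h0.le hL.le hr hθ hz pr pθ hτ)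
  rw [← hD] at main
  have hfin : ∫ q in shell (s ^ 2) L, gradSq fr fθ fz q ≤
      100 * (D * ((1 / s) ^ 3 * (9 / 2 * ∫ q in shell (s ^ 2) L, eSq fr fθ fz q))) := by
    have : D * ((1 / s) ^ 3 * X) ≤
        D * ((1 / s) ^ 3 * (9 / 2 * ∫ q in shell (s ^ 2) L, eSq fr fθ fz q)) := by gcongr
    linarith
  rw [hpow]
  calc 1 / (450 * D) * s ^ 3 * ∫ q in shell (s ^ 2) L, gradSq fr fθ fz q
      ≤ 1 / (450 * D) * s ^ 3 *
        (100 * (D * ((1 / s) ^ 3 * (9 / 2 * ∫ q in shell (s ^ 2) L, eSq fr fθ fz q)))) := by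
        gcongr
    _ = _ := by
        field_simp
        ring
end
end
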